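/- Fix r ≥ 1. If the rate pair (R₁₂, R₂₁) is admissible for q with r interactive rounds of communication, then (R₁₂, R₂₁) belongs to the closed convex hull of the set of pairs (R'₁₂, R'₂₁) ∈ ℝ² for which there exists a pmf p(f₁,…,f_r, x¹, x², y¹, y²) whose (x¹,x²,y¹,y²)-marginal equals q, satisfying the Markov chains F_i – (F_{1:i-1},X¹) – X² for odd i, F_i – (F_{1:i-1},X²) – X¹ for even i, Y¹ – (F_{1:r},X¹) – (X²,Y²), and Y² – (F_{1:r},X²) – (X¹,Y¹), with |𝓕_i| ≤ |𝓕_{i-1}||𝓕_{i-2}|···|𝓕_1|·|𝒳¹||𝒴¹||𝒳²||𝒴²| + 1 for all 1 ≤ i ≤ r, such that R'₁₂ ≥ I_p(X¹; F_{1:r} | X²), R'₂₁ ≥ I_p(X²; F_{1:r} | X¹), and R'₁₂ + R'₂₁ ≥ I_p(X¹; F_{1:r} | X²) + I_p(X²; F_{1:r} | X¹) + I_q(Y¹; Y² | X¹, X²). -/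

import Mathlib

open scoped BigOperators
open Finset

noncomputable section

namespace Coord

variable {Ω α β γ : Type*}

/-- `p` is a probability mass function on the finite type `α`. -/
def IsPMF [Fintype α] (p : α → ℝ) : Prop := (∀ a, 0 ≤ p a) ∧ ∑ a, p a = 1

/-- ℓ¹ (total variation) distance between two functions on a finite type. -/
def l1dist [Fintype α] (p q : α → ℝ) : ℝ := ∑ a, |p a - q a|

/-- The distribution (pushforward pmf) of the random variable `X` defined on the
finite sample space `Ω` carrying the pmf `μ`. -/
def distr [Fintype Ω] [DecidableEq α] (μ : Ω → ℝ) (X : Ω → α) : α → ℝ :=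
  fun a => ∑ ω, if X ω = a then μ ω else 0

/-- Shannon entropy (base 2) of a pmf. -/
def entFun [Fintype α] (p : α → ℝ) : ℝ := - ∑ a, p a * Real.logb 2 (p a)

/-- Shannon entropy `H(X)` of a random variable `X` on `(Ω, μ)`. -/
def H [Fintype Ω] [Fintype α] [DecidableEq α] (μ : Ω → ℝ) (X : Ω → α) : ℝ :=
  entFun (distr μ X)

/-- Conditional entropy `H(X | Z)`. -/
def condEnt [Fintype Ω] [Fintype α] [Fintype γ] [DecidableEq α] [DecidableEq γ]
    (μ : Ω → ℝ) (X : Ω → α) (Z : Ω → γ) : ℝ :=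
  H μ (fun ω => (X ω, Z ω)) - H μ Z

/-- Mutual information `I(X; Y)`. -/
def mi [Fintype Ω] [Fintype α] [Fintype β] [DecidableEq α] [DecidableEq β]
    (μ : Ω → ℝ) (X : Ω → α) (Y : Ω → β) : ℝ :=
  H μ X + H μ Y - H μ (fun ω => (X ω, Y ω))

/-- Conditional mutual information `I(X; Y | Z)`. -/
def cmi [Fintype Ω] [Fintype α] [Fintype β] [Fintype γ]
    [DecidableEq α] [DecidableEq β] [DecidableEq γ]
    (μ : Ω → ℝ) (X : Ω → α) (Y : Ω → β) (Z : Ω → γ) : ℝ :=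
  H μ (fun ω => (X ω, Z ω)) + H μ (fun ω => (Y ω, Z ω))
    - H μ (fun ω => (X ω, Y ω, Z ω)) - H μ Z

variable {𝒳₁ 𝒳₂ 𝒴₁ 𝒴₂ : Type}

/-- The `(x¹, x²)`-marginal of `q(x¹, x², y¹, y²)`. -/
def srcMarg [Fintype 𝒴₁] [Fintype 𝒴₂] (q : 𝒳₁ × 𝒳₂ × 𝒴₁ × 𝒴₂ → ℝ) :
    𝒳₁ × 𝒳₂ → ℝ := fun x => ∑ y₁, ∑ y₂, q (x.1, x.2, y₁, y₂)

/-- The rate pair `(R12, R21)` is admissible for the coordination problem `q` with `r`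
interactive rounds of communication: for every `ε > 0`, for all large enough block
lengths `n`, there is a finite probability space carrying the i.i.d. sources, private
randomness `M₁, M₂`, interactive messages `C i` (messages with even Lean-index,
i.e. odd 1-based index, are sent by the first node), and outputs `Y₁, Y₂`,
meeting the rate constraints and approximating the i.i.d. target distribution
within total variation `ε`. -/
def Admissible [Fintype 𝒳₁] [Fintype 𝒳₂] [Fintype 𝒴₁] [Fintype 𝒴₂]
    [DecidableEq 𝒳₁] [DecidableEq 𝒳₂] [DecidableEq 𝒴₁] [DecidableEq 𝒴₂]
    (q : 𝒳₁ × 𝒳₂ × 𝒴₁ × 𝒴₂ → ℝ) (r : ℕ) (R12 R21 : ℝ) : Prop :=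
  ∀ ε : ℝ, 0 < ε → ∃ n₀ : ℕ, ∀ n : ℕ, n₀ ≤ n →
    ∃ (Ω 𝓜₁ 𝓜₂ : Type) (𝓒 : Fin r → Type)
      (_ : Fintype Ω) (_ : DecidableEq Ω)
      (_ : Fintype 𝓜₁) (_ : DecidableEq 𝓜₁)
      (_ : Fintype 𝓜₂) (_ : DecidableEq 𝓜₂)
      (_ : ∀ i, Fintype (𝓒 i)) (_ : ∀ i, DecidableEq (𝓒 i))
      (μ : Ω → ℝ)
      (X₁ : Ω → Fin n → 𝒳₁) (X₂ : Ω → Fin n → 𝒳₂)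
      (M₁ : Ω → 𝓜₁) (M₂ : Ω → 𝓜₂)
      (C : (i : Fin r) → Ω → 𝓒 i)
      (Y₁ : Ω → Fin n → 𝒴₁) (Y₂ : Ω → Fin n → 𝒴₂),
      IsPMF μ ∧
      -- the source pairs are i.i.d. with per-letter distribution the (x¹,x²)-marginal of q
      (distr μ (fun ω => (X₁ ω, X₂ ω)) =
        fun x => ∏ k, srcMarg q (x.1 k, x.2 k)) ∧
      -- M₁, M₂ and the sources are mutually independent
      (distr μ (fun ω => (M₁ ω, M₂ ω, X₁ ω, X₂ ω)) =
        fun m => distr μ M₁ m.1 * distr μ M₂ m.2.1 *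
          distr μ (fun ω => (X₁ ω, X₂ ω)) m.2.2) ∧
      -- messages with odd 1-based index are functions of (previous messages, X¹, M₁)
      (∀ i : Fin r, (i : ℕ) % 2 = 0 →
        condEnt μ (C i)
          (fun ω => ((fun j : Fin (i : ℕ) => C ⟨j.1, j.2.trans i.2⟩ ω), X₁ ω, M₁ ω)) = 0) ∧
      -- messages with even 1-based index are functions of (previous messages, X², M₂)
      (∀ i : Fin r, (i : ℕ) % 2 = 1 →
        condEnt μ (C i)
          (fun ω => ((fun j : Fin (i : ℕ) => C ⟨j.1, j.2.trans i.2⟩ ω), X₂ ω, M₂ ω)) = 0) ∧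
      -- rate constraints
      (∑ i ∈ Finset.univ.filter (fun i : Fin r => (i : ℕ) % 2 = 0), H μ (C i)) ≤ n * R12 ∧
      (∑ i ∈ Finset.univ.filter (fun i : Fin r => (i : ℕ) % 2 = 1), H μ (C i)) ≤ n * R21 ∧
      -- the outputs are produced from the locally available information
      condEnt μ Y₁ (fun ω => (X₁ ω, M₁ ω, fun i : Fin r => C i ω)) = 0 ∧
      condEnt μ Y₂ (fun ω => (X₂ ω, M₂ ω, fun i : Fin r => C i ω)) = 0 ∧
      -- total variation distance to the i.i.d. target is at most ε
      l1dist (distr μ (fun ω => (X₁ ω, X₂ ω, Y₁ ω, Y₂ ω)))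
        (fun a => ∏ k, q (a.1 k, a.2.1 k, a.2.2.1 k, a.2.2.2 k)) ≤ ε

/-- `Y` is a function of `X` on the support of `μ`. -/
def Det (μ : Ω → ℝ) (Y : Ω → β) (X : Ω → α) : Prop :=
  ∀ ω ω', μ ω ≠ 0 → μ ω' ≠ 0 → X ω = X ω' → Y ω = Y ω'

section Entropy

variable [Fintype Ω] {μ : Ω → ℝ}

theorem distr_nonneg [DecidableEq α] (hμ : ∀ ω, 0 ≤ μ ω) (X : Ω → α) (a : α) :
    0 ≤ distr μ X a :=
  Finset.sum_nonneg fun ω _ => by split_ifs <;> simp [hμ]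

theorem sum_distr_mul [Fintype α] [DecidableEq α] (μ : Ω → ℝ) (X : Ω → α) (g : α → ℝ) :
    ∑ a, distr μ X a * g a = ∑ ω, μ ω * g (X ω) := by
  simp only [distr, Finset.sum_mul, ite_mul, zero_mul]
  rw [Finset.sum_comm]
  simp

theorem sum_distr [Fintype α] [DecidableEq α] (μ : Ω → ℝ) (X : Ω → α) :
    ∑ a, distr μ X a = ∑ ω, μ ω := by
  simpa using sum_distr_mul μ X (fun _ => 1)

theorem IsPMF.distr [Fintype α] [DecidableEq α] (hμ : IsPMF μ) (X : Ω → α) :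
    IsPMF (distr μ X) :=
  ⟨distr_nonneg hμ.1 X, by rw [sum_distr, hμ.2]⟩

theorem distr_distr [Fintype α] [DecidableEq α] [DecidableEq β] (μ : Ω → ℝ) (X : Ω → α)
    (f : α → β) : distr (distr μ X) f = distr μ (fun ω => f (X ω)) := by
  funext b
  simpa [distr] using sum_distr_mul μ X (fun a => if f a = b then 1 else 0)

theorem H_distr [Fintype α] [DecidableEq α] [Fintype β] [DecidableEq β] (μ : Ω → ℝ) (X : Ω → α)
    (f : α → β) : H (distr μ X) f = H μ (fun ω => f (X ω)) := by
  rw [H, H, distr_distr]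

theorem H_eq_sum [Fintype α] [DecidableEq α] (μ : Ω → ℝ) (X : Ω → α) :
    H μ X = -∑ ω, μ ω * Real.logb 2 (distr μ X (X ω)) := by
  rw [H, entFun, sum_distr_mul μ X (fun a => Real.logb 2 (distr μ X a))]

theorem le_distr [DecidableEq α] (hμ : ∀ ω, 0 ≤ μ ω) (X : Ω → α) (ω : Ω) :
    μ ω ≤ distr μ X (X ω) := by
  have := Finset.single_le_sum (f := fun ω' => if X ω' = X ω then μ ω' else 0)
    (fun i _ => by split_ifs <;> simp [hμ]) (Finset.mem_univ ω)
  simp only [if_true] at this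
  exact this

theorem distr_pos [DecidableEq α] (hμ : ∀ ω, 0 ≤ μ ω) (X : Ω → α) {ω : Ω} (h : μ ω ≠ 0) :
    0 < distr μ X (X ω) :=
  lt_of_lt_of_le (lt_of_le_of_ne (hμ ω) h.symm) (le_distr hμ X ω)

theorem Det.distr_le [DecidableEq α] [DecidableEq β] (hμ : ∀ ω, 0 ≤ μ ω) {X : Ω → α} {Y : Ω → β}
    (h : Det μ Y X) {ω : Ω} (hω : μ ω ≠ 0) : distr μ X (X ω) ≤ distr μ Y (Y ω) := by
  refine Finset.sum_le_sum fun ω' _ => ?_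
  by_cases h0 : μ ω' = 0
  · simp [h0]
  by_cases hX : X ω' = X ω
  · simp [hX, h ω' ω h0 hω hX]
  · rw [if_neg hX]
    split_ifs <;> simp [hμ]

theorem H_mono [Fintype α] [DecidableEq α] [Fintype β] [DecidableEq β] (hμ : ∀ ω, 0 ≤ μ ω)
    {X : Ω → α} {Y : Ω → β} (h : Det μ Y X) : H μ Y ≤ H μ X := by
  rw [H_eq_sum, H_eq_sum, neg_le_neg_iff]
  refine Finset.sum_le_sum fun ω _ => ?_
  by_cases h0 : μ ω = 0
  · simp [h0]
  · refine mul_le_mul_of_nonneg_left ?_ (hμ ω)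
    exact Real.logb_le_logb_of_le (by norm_num) (distr_pos hμ X h0) (h.distr_le hμ h0)

theorem H_congr [Fintype α] [DecidableEq α] [Fintype β] [DecidableEq β] (hμ : ∀ ω, 0 ≤ μ ω)
    {X : Ω → α} {Y : Ω → β} (h : Det μ Y X) (h' : Det μ X Y) : H μ Y = H μ X :=
  le_antisymm (H_mono hμ h) (H_mono hμ h')

theorem det_of_condEnt_eq_zero [Fintype α] [DecidableEq α] [Fintype γ] [DecidableEq γ]
    (hμ : ∀ ω, 0 ≤ μ ω) {X : Ω → α} {Z : Ω → γ} (h : condEnt μ X Z = 0) : Det μ X Z := by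
  have hdet : Det μ Z (fun ω => (X ω, Z ω)) := fun ω ω' _ _ e => (Prod.ext_iff.1 e).2
  rw [condEnt, H_eq_sum, H_eq_sum, neg_sub_neg, ← Finset.sum_sub_distrib,
    Finset.sum_eq_zero_iff_of_nonneg] at h
  · intro ω ω' h0 h0' e
    by_contra hne
    have h1 := h ω (Finset.mem_univ _)
    have hlt : distr μ (fun ω => (X ω, Z ω)) (X ω, Z ω) < distr μ Z (Z ω) := by
      refine Finset.sum_lt_sum (fun ω'' _ => ?_) ⟨ω', Finset.mem_univ _, ?_⟩
      · by_cases hz : Z ω'' = Z ω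
        · simp only [hz, if_true]
          split_ifs <;> simp [hμ]
        · simp [hz]
      · rw [if_neg (by simp [Ne.symm hne]), if_pos e.symm]
        exact lt_of_le_of_ne (hμ ω') h0'.symm
    have := Real.logb_lt_logb (b := 2) (by norm_num)
      (distr_pos hμ (fun ω => (X ω, Z ω)) h0) hlt
    rw [← mul_sub, mul_eq_zero] at h1
    rcases h1 with h1 | h1
    · exact h0 h1
    · linarith
  · intro ω _
    rw [← mul_sub]
    by_cases h0 : μ ω = 0
    · simp [h0]
    refine mul_nonneg (hμ ω) (sub_nonneg.2 ?_)
    exact Real.logb_le_logb_of_le (by norm_num) (distr_pos hμ (fun ω => (X ω, Z ω)) h0)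
      (hdet.distr_le hμ h0)

theorem sum_distr_pair_left [Fintype α] [DecidableEq α] [DecidableEq γ] (μ : Ω → ℝ) (X : Ω → α)
    (Z : Ω → γ) (z : γ) : ∑ a, distr μ (fun ω => (X ω, Z ω)) (a, z) = distr μ Z z := by
  simp only [distr, Prod.mk.injEq]
  rw [Finset.sum_comm]
  refine Finset.sum_congr rfl fun ω _ => ?_
  by_cases h : Z ω = z <;> simp [h]

theorem distr_pair_le [DecidableEq α] [DecidableEq γ] (hμ : ∀ ω, 0 ≤ μ ω) (X : Ω → α)
    (Z : Ω → γ) (a : α) (z : γ) : distr μ (fun ω => (X ω, Z ω)) (a, z) ≤ distr μ Z z := by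
  refine Finset.sum_le_sum fun ω _ => ?_
  by_cases h : Z ω = z
  · simp only [h, Prod.mk.injEq, and_true, if_true]
    split_ifs <;> simp [hμ]
  · simp [h]

theorem cmi_summand_nonneg [DecidableEq α] [DecidableEq β] [DecidableEq γ]
    (hμ : ∀ ω, 0 ≤ μ ω) (A : Ω → α) (B : Ω → β) (Z : Ω → γ)
    (t : α × β × γ) :
    0 ≤ distr μ (fun ω => (A ω, Z ω)) (t.1, t.2.2) * distr μ (fun ω => (B ω, Z ω)) t.2 /
        distr μ Z t.2.2 *
        InformationTheory.klFun (distr μ (fun ω => (A ω, B ω, Z ω)) t /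
          (distr μ (fun ω => (A ω, Z ω)) (t.1, t.2.2) * distr μ (fun ω => (B ω, Z ω)) t.2 /
            distr μ Z t.2.2)) := by
  have h1 := distr_nonneg hμ (fun ω => (A ω, Z ω)) (t.1, t.2.2)
  have h2 := distr_nonneg hμ (fun ω => (B ω, Z ω)) t.2
  have h3 := distr_nonneg hμ Z t.2.2
  have h4 := distr_nonneg hμ (fun ω => (A ω, B ω, Z ω)) t
  exact mul_nonneg (by positivity) (InformationTheory.klFun_nonneg (by positivity))

section Triple

variable [Fintype α] [Fintype β] [Fintype γ] [DecidableEq α] [DecidableEq β] [DecidableEq γ]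

theorem cmi_mul_log_two (hμ : ∀ ω, 0 ≤ μ ω) (A : Ω → α) (B : Ω → β) (Z : Ω → γ) :
    cmi μ A B Z * Real.log 2 = ∑ t : α × β × γ,
      distr μ (fun ω => (A ω, Z ω)) (t.1, t.2.2) * distr μ (fun ω => (B ω, Z ω)) t.2 /
        distr μ Z t.2.2 *
        InformationTheory.klFun (distr μ (fun ω => (A ω, B ω, Z ω)) t /
          (distr μ (fun ω => (A ω, Z ω)) (t.1, t.2.2) * distr μ (fun ω => (B ω, Z ω)) t.2 /
            distr μ Z t.2.2)) := by
  set P := distr μ (fun ω => (A ω, B ω, Z ω)) with hP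
  set PA := distr μ (fun ω => (A ω, Z ω)) with hPA
  set PB := distr μ (fun ω => (B ω, Z ω)) with hPB
  set PZ := distr μ Z with hPZ
  have hterm : ∀ t : α × β × γ, PA (t.1, t.2.2) * PB t.2 / PZ t.2.2 *
      InformationTheory.klFun (P t / (PA (t.1, t.2.2) * PB t.2 / PZ t.2.2)) =
      P t * (Real.log (P t) + Real.log (PZ t.2.2) - Real.log (PA (t.1, t.2.2))
        - Real.log (PB t.2)) + PA (t.1, t.2.2) * PB t.2 / PZ t.2.2 - P t := by
    rintro ⟨a, b, z⟩
    have h0 : 0 ≤ P (a, b, z) := distr_nonneg hμ _ _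
    have h1 : P (a, b, z) ≤ PB (b, z) := distr_pair_le hμ A (fun ω => (B ω, Z ω)) a (b, z)
    have h2 : P (a, b, z) ≤ PA (a, z) := by
      refine Finset.sum_le_sum fun ω _ => ?_
      by_cases h : A ω = a ∧ Z ω = z
      · simp only [h.1, h.2, Prod.mk.injEq, true_and, and_true, if_true]
        split_ifs <;> simp [hμ]
      · have : ¬ (A ω = a ∧ B ω = b ∧ Z ω = z) := fun h' => h ⟨h'.1, h'.2.2⟩
        simp [h, this]
    have h3 : PB (b, z) ≤ PZ z := distr_pair_le hμ B Z b z
    rcases h0.eq_or_lt with h0 | h0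
    · rw [← h0]; simp [InformationTheory.klFun]
    · have h4 : 0 < PA (a, z) := by linarith
      have h5 : 0 < PB (b, z) := by linarith
      have h6 : 0 < PZ z := by linarith
      simp only [InformationTheory.klFun]
      rw [Real.log_div h0.ne' (by positivity), Real.log_div (by positivity) h6.ne',
        Real.log_mul h4.ne' h5.ne']
      field_simp
      ring
  rw [Finset.sum_congr rfl fun t _ => hterm t, Finset.sum_sub_distrib, Finset.sum_add_distrib]
  have hsum : ∑ t : α × β × γ, PA (t.1, t.2.2) * PB t.2 / PZ t.2.2 = ∑ t, P t := by
    rw [hP, sum_distr, ← sum_distr μ Z, Fintype.sum_prod_type]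
    simp only [Fintype.sum_prod_type]
    rw [Finset.sum_congr rfl fun a _ => Finset.sum_comm, Finset.sum_comm]
    refine Finset.sum_congr rfl fun z _ => ?_
    simp only [← Finset.sum_div, ← Finset.mul_sum, ← Finset.sum_mul]
    rw [hPA, hPB, sum_distr_pair_left, sum_distr_pair_left]
    exact mul_self_div_self _
  rw [hsum, add_sub_cancel_right, hP, sum_distr_mul μ (fun ω => (A ω, B ω, Z ω)) (fun t =>
    (Real.log (P t) + Real.log (PZ t.2.2) - Real.log (PA (t.1, t.2.2)) - Real.log (PB t.2)))]
  rw [cmi, H_eq_sum, H_eq_sum, H_eq_sum, H_eq_sum]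
  simp only [mul_sub, mul_add, Finset.sum_sub_distrib, Finset.sum_add_distrib, Real.logb,
    mul_div_assoc', ← Finset.sum_div]
  have : Real.log 2 ≠ 0 := (Real.log_pos (by norm_num)).ne'
  field_simp
  ring

theorem cmi_nonneg (hμ : ∀ ω, 0 ≤ μ ω) (A : Ω → α) (B : Ω → β) (Z : Ω → γ) :
    0 ≤ cmi μ A B Z := by
  have h := cmi_mul_log_two hμ A B Z
  have h2 : 0 ≤ cmi μ A B Z * Real.log 2 := by
    rw [h]; exact Finset.sum_nonneg fun t _ => cmi_summand_nonneg hμ A B Z t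
  exact nonneg_of_mul_nonneg_left h2 (Real.log_pos (by norm_num))

theorem cmi_eq_zero_iff (hμ : ∀ ω, 0 ≤ μ ω) (A : Ω → α) (B : Ω → β) (Z : Ω → γ) :
    cmi μ A B Z = 0 ↔ ∀ a b z, distr μ (fun ω => (A ω, B ω, Z ω)) (a, b, z) * distr μ Z z =
      distr μ (fun ω => (A ω, Z ω)) (a, z) * distr μ (fun ω => (B ω, Z ω)) (b, z) := by
  have hlog : Real.log 2 ≠ 0 := (Real.log_pos (by norm_num)).ne'
  rw [← mul_left_inj' hlog, zero_mul, cmi_mul_log_two hμ,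
    Finset.sum_eq_zero_iff_of_nonneg fun t _ => cmi_summand_nonneg hμ A B Z t]
  have key : ∀ t : α × β × γ,
      (distr μ (fun ω => (A ω, Z ω)) (t.1, t.2.2) * distr μ (fun ω => (B ω, Z ω)) t.2 /
        distr μ Z t.2.2 *
        InformationTheory.klFun (distr μ (fun ω => (A ω, B ω, Z ω)) t /
          (distr μ (fun ω => (A ω, Z ω)) (t.1, t.2.2) * distr μ (fun ω => (B ω, Z ω)) t.2 /
            distr μ Z t.2.2)) = 0 ↔ distr μ (fun ω => (A ω, B ω, Z ω)) t * distr μ Z t.2.2 =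
      distr μ (fun ω => (A ω, Z ω)) (t.1, t.2.2) * distr μ (fun ω => (B ω, Z ω)) t.2) := by
    rintro ⟨a, b, z⟩
    have h1 := distr_nonneg hμ (fun ω => (A ω, Z ω)) (a, z)
    have h2 := distr_nonneg hμ (fun ω => (B ω, Z ω)) (b, z)
    have h3 := distr_nonneg hμ Z z
    have h4 := distr_nonneg hμ (fun ω => (A ω, B ω, Z ω)) (a, b, z)
    have h5 : distr μ (fun ω => (A ω, B ω, Z ω)) (a, b, z) ≤ distr μ (fun ω => (B ω, Z ω)) (b, z) :=
      distr_pair_le hμ A (fun ω => (B ω, Z ω)) a (b, z)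
    have h6 := distr_pair_le hμ B Z b z
    have h7 := distr_pair_le hμ A Z a z
    have h8 : distr μ (fun ω => (A ω, B ω, Z ω)) (a, b, z) ≤
        distr μ (fun ω => (A ω, Z ω)) (a, z) := by
      refine Finset.sum_le_sum fun ω _ => ?_
      by_cases h : A ω = a ∧ Z ω = z
      · simp only [h.1, h.2, Prod.mk.injEq, true_and, and_true, if_true]
        split_ifs <;> simp [hμ]
      · have : ¬ (A ω = a ∧ B ω = b ∧ Z ω = z) := fun h' => h ⟨h'.1, h'.2.2⟩
        simp [h, this]
    dsimp only
    rcases h3.eq_or_lt with h3 | h3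
    · rw [← h3]; rw [← h3] at h6 h7
      have e1 := le_antisymm h7 h1
      simp [e1]
    rcases h1.eq_or_lt with h1 | h1
    · rw [← h1] at h8 ⊢
      simp [le_antisymm h8 h4]
    rcases h2.eq_or_lt with h2 | h2
    · rw [← h2] at h5 ⊢
      simp [le_antisymm h5 h4]
    have hu : 0 < distr μ (fun ω => (A ω, Z ω)) (a, z) * distr μ (fun ω => (B ω, Z ω)) (b, z) /
        distr μ Z z := by positivity
    rw [mul_eq_zero, or_iff_right hu.ne', InformationTheory.klFun_eq_zero_iff (by positivity),
      div_eq_one_iff_eq hu.ne', eq_div_iff h3.ne']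
  constructor
  · intro h a b z
    exact (key (a, b, z)).1 (h (a, b, z) (Finset.mem_univ _))
  · rintro h ⟨a, b, z⟩ _
    exact (key (a, b, z)).2 (h a b z)

end Triple

/-- Submodularity of entropy. -/
theorem H_submod {δ ε : Type*} [Fintype α] [Fintype β] [Fintype δ] [Fintype ε]
    [DecidableEq α] [DecidableEq β] [DecidableEq δ] [DecidableEq ε] (hμ : ∀ ω, 0 ≤ μ ω)
    (S : Ω → α) (T : Ω → β) (U : Ω → δ) (I : Ω → ε)
    (hU : Det μ U (fun ω => (S ω, T ω))) (hS : Det μ I S) (hT : Det μ I T) :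
    H μ U + H μ I ≤ H μ S + H μ T := by
  have h := cmi_nonneg hμ S T I
  have h1 : H μ (fun ω => (S ω, I ω)) ≤ H μ S :=
    H_mono hμ fun ω ω' a b e => Prod.ext e (hS ω ω' a b e)
  have h2 : H μ (fun ω => (T ω, I ω)) ≤ H μ T :=
    H_mono hμ fun ω ω' a b e => Prod.ext e (hT ω ω' a b e)
  have h3 : H μ U ≤ H μ (fun ω => (S ω, T ω, I ω)) :=
    H_mono hμ fun ω ω' a b e => hU ω ω' a b (by simp_all)
  rw [cmi] at h
  linarith

theorem cmi_mono {α' β' γ' : Type*} [Fintype α] [Fintype β] [Fintype γ]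
    [DecidableEq α] [DecidableEq β] [DecidableEq γ] [Fintype α'] [Fintype β'] [Fintype γ']
    [DecidableEq α'] [DecidableEq β'] [DecidableEq γ'] (hμ : ∀ ω, 0 ≤ μ ω)
    {A : Ω → α} {B : Ω → β} {Z : Ω → γ} {A' : Ω → α'} {B' : Ω → β'} {Z' : Ω → γ'}
    (hA : Det μ A' (fun ω => (A ω, Z ω))) (hB : Det μ B' (fun ω => (B ω, Z ω)))
    (hZ : Det μ Z' Z) (hZ' : Det μ Z Z') : cmi μ A' B' Z' ≤ cmi μ A B Z := by
  have h1 := H_submod hμ (fun ω => (A ω, Z ω)) (fun ω => (A' ω, B' ω, Z' ω))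
    (fun ω => (A ω, B' ω, Z ω)) (fun ω => (A' ω, Z' ω))
    (by intro ω ω' a b e; simp only [Prod.mk.injEq] at e ⊢; tauto)
    (by intro ω ω' a b e
        have := hA ω ω' a b; have := hZ ω ω' a b; simp only [Prod.mk.injEq] at *; tauto)
    (by intro ω ω' a b e; simp only [Prod.mk.injEq] at e ⊢; tauto)
  have h2 := H_submod hμ (fun ω => (B ω, Z ω)) (fun ω => (A ω, B' ω, Z ω))
    (fun ω => (A ω, B ω, Z ω)) (fun ω => (B' ω, Z' ω))
    (by intro ω ω' a b e; simp only [Prod.mk.injEq] at e ⊢; tauto)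
    (by intro ω ω' a b e
        have := hB ω ω' a b; have := hZ ω ω' a b; simp only [Prod.mk.injEq] at *; tauto)
    (by intro ω ω' a b e
        have := hZ ω ω' a b; simp only [Prod.mk.injEq] at *; tauto)
  have h3 := H_congr hμ hZ hZ'
  simp only [cmi]
  linarith

theorem cmi_congr {α' β' γ' : Type*} [Fintype α] [Fintype β] [Fintype γ]
    [DecidableEq α] [DecidableEq β] [DecidableEq γ] [Fintype α'] [Fintype β'] [Fintype γ']
    [DecidableEq α'] [DecidableEq β'] [DecidableEq γ'] (hμ : ∀ ω, 0 ≤ μ ω)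
    {A : Ω → α} {B : Ω → β} {Z : Ω → γ} {A' : Ω → α'} {B' : Ω → β'} {Z' : Ω → γ'}
    (hA : Det μ A' (fun ω => (A ω, Z ω))) (hB : Det μ B' (fun ω => (B ω, Z ω)))
    (hZ : Det μ Z' Z) (hA' : Det μ A (fun ω => (A' ω, Z' ω)))
    (hB' : Det μ B (fun ω => (B' ω, Z' ω))) (hZ' : Det μ Z Z') :
    cmi μ A' B' Z' = cmi μ A B Z :=
  le_antisymm (cmi_mono hμ hA hB hZ hZ') (cmi_mono hμ hA' hB' hZ' hZ)

theorem cmi_distr [Fintype α] [DecidableEq α] {β γ δ : Type*} [Fintype β] [DecidableEq β]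
    [Fintype γ] [DecidableEq γ] [Fintype δ] [DecidableEq δ] (μ : Ω → ℝ) (X : Ω → α)
    (f : α → β) (g : α → γ) (h : α → δ) :
    cmi (distr μ X) f g h =
      cmi μ (fun ω => f (X ω)) (fun ω => g (X ω)) (fun ω => h (X ω)) := by
  simp only [cmi, H_distr]

end Entropy

section Product

variable [Fintype Ω] {μ : Ω → ℝ} {n : ℕ}

theorem distr_pi [Fintype α] [DecidableEq α] [DecidableEq β] {W : Ω → Fin n → α} {P : α → ℝ}
    (hW : distr μ W = fun w => ∏ k, P (w k)) (g : Fin n → α → β) :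
    distr μ (fun ω k => g k (W ω k)) = fun b => ∏ k, distr P (g k) (b k) := by
  rw [← distr_distr μ W (fun w k => g k (w k)), hW]
  funext b
  simp only [distr]
  rw [Finset.prod_univ_sum, Fintype.piFinset_univ]
  refine Finset.sum_congr rfl fun w _ => ?_
  by_cases h : (fun k => g k (w k)) = b
  · subst h; simp
  · rw [if_neg h]
    obtain ⟨k, hk⟩ := Function.ne_iff.1 h
    exact (Finset.prod_eq_zero (Finset.mem_univ k) (if_neg hk)).symm

theorem entFun_pi [Fintype α] {p : Fin n → α → ℝ} (hp : ∀ k, ∑ a, p k a = 1) :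
    entFun (fun b : Fin n → α => ∏ k, p k (b k)) = ∑ k, entFun (p k) := by
  have h1 : ∀ b : Fin n → α, (∏ k, p k (b k)) * Real.logb 2 (∏ k, p k (b k)) =
      ∑ k, ∏ j, (if j = k then p j (b j) * Real.logb 2 (p j (b j)) else p j (b j)) := by
    intro b
    by_cases h0 : ∏ k, p k (b k) = 0
    · rw [h0, zero_mul]
      obtain ⟨i, -, hi⟩ := Finset.prod_eq_zero_iff.1 h0
      refine (Finset.sum_eq_zero fun k _ => Finset.prod_eq_zero (Finset.mem_univ i) ?_).symm
      simp [hi]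
    · rw [Real.logb_prod _ _ (fun k hk => Finset.prod_ne_zero_iff.1 h0 k hk), Finset.mul_sum]
      refine Finset.sum_congr rfl fun k _ => ?_
      rw [← Finset.mul_prod_erase _ _ (Finset.mem_univ k),
        ← Finset.mul_prod_erase _ _ (Finset.mem_univ k), if_pos rfl, mul_right_comm]
      congr 1
      exact Finset.prod_congr rfl fun j hj => (if_neg (Finset.ne_of_mem_erase hj)).symm
  simp only [entFun]
  rw [Finset.sum_congr rfl fun b _ => h1 b, Finset.sum_comm, ← Finset.sum_neg_distrib]
  refine Finset.sum_congr rfl fun k _ => ?_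
  have h2 := Finset.prod_univ_sum (fun _ : Fin n => (Finset.univ : Finset α))
    (fun j a => if j = k then p j a * Real.logb 2 (p j a) else p j a)
  rw [Fintype.piFinset_univ] at h2
  rw [← h2, Finset.prod_eq_single k]
  · simp
  · intro j _ hj
    simp [hj, hp]
  · simp

/-- Entropy of letterwise functions of an i.i.d. sequence. -/
theorem H_pi [Fintype α] [DecidableEq α] [Fintype β] [DecidableEq β] {W : Ω → Fin n → α}
    {P : α → ℝ} (hP : ∑ a, P a = 1) (hW : distr μ W = fun w => ∏ k, P (w k))
    (g : Fin n → α → β) : H μ (fun ω k => g k (W ω k)) = ∑ k, H P (g k) := by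
  rw [H, distr_pi hW, entFun_pi]
  · rfl
  · intro k
    rw [sum_distr, hP]

theorem distr_pi_eval [Fintype α] [DecidableEq α] {W : Ω → Fin n → α} {P : α → ℝ}
    (hP : ∑ a, P a = 1) (hW : distr μ W = fun w => ∏ k, P (w k)) (k : Fin n) :
    distr μ (fun ω => W ω k) = P := by
  classical
  funext a
  rw [← distr_distr μ W (fun w => w k), hW]
  simp only [distr]
  have h2 := Finset.prod_univ_sum (fun _ : Fin n => (Finset.univ : Finset α))
    (fun j b => if j = k then (if b = a then P b else 0) else P b)
  rw [Fintype.piFinset_univ, Finset.prod_eq_single k (fun j _ hj => by simp [hj, hP])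
    (by simp)] at h2
  simp only [if_true, Finset.sum_ite_eq', Finset.mem_univ] at h2
  rw [h2]
  refine Finset.sum_congr rfl fun w _ => ?_
  rw [← Finset.mul_prod_erase _ _ (Finset.mem_univ k),
    ← Finset.mul_prod_erase _ _ (Finset.mem_univ k), if_pos rfl]
  rw [Finset.prod_congr (s₁ := Finset.univ.erase k) rfl
    fun j hj => if_neg (Finset.ne_of_mem_erase hj)]
  by_cases h : w k = a <;> simp [h]

end Product

section Continuity

theorem negMulLog_sub_le {x y : ℝ} (hx : 0 ≤ x) (hx1 : x ≤ 1) (hy : 0 ≤ y) (hy1 : y ≤ 1) :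
    Real.negMulLog x - Real.negMulLog y ≤ Real.negMulLog |x - y| + |x - y| := by
  rcases le_total y x with h | h
  · rw [abs_of_nonneg (sub_nonneg.2 h)]
    obtain ⟨d, rfl⟩ : ∃ d, x = y + d := ⟨x - y, by ring⟩
    have hd : 0 ≤ d := by linarith
    rw [add_sub_cancel_left]
    rcases hy.eq_or_lt with rfl | hy0
    · simp [hd]
    rcases hd.eq_or_lt with rfl | hd0
    · simp
    have h1 := Real.log_le_log hy0 (by linarith : y ≤ y + d)
    have h2 := Real.log_le_log hd0 (by linarith : d ≤ y + d)
    simp only [Real.negMulLog]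
    nlinarith
  · rw [abs_of_nonpos (sub_nonpos.2 h), neg_sub]
    obtain ⟨d, rfl⟩ : ∃ d, y = x + d := ⟨y - x, by ring⟩
    have hd : 0 ≤ d := by linarith
    rw [add_sub_cancel_left]
    have h0 : 0 ≤ Real.negMulLog d := Real.negMulLog_nonneg hd (by linarith)
    rcases hx.eq_or_lt with rfl | hx0
    · simp only [zero_add, Real.negMulLog_zero]
      linarith
    have h3 : Real.log (x + d) ≤ 0 := Real.log_nonpos hy hy1
    have h4 : Real.log ((x + d) / x) ≤ (x + d) / x - 1 :=
      Real.log_le_sub_one_of_pos (by positivity)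
    rw [Real.log_div (by positivity) hx0.ne'] at h4
    have h5 : x * (Real.log (x + d) - Real.log x) ≤ d := by
      calc _ ≤ x * ((x + d) / x - 1) := mul_le_mul_of_nonneg_left h4 hx
        _ = d := by field_simp; ring
    simp only [Real.negMulLog] at h0 ⊢
    nlinarith

theorem IsPMF.le_one [Fintype α] {p : α → ℝ} (hp : IsPMF p) (a : α) : p a ≤ 1 := by
  rw [← hp.2]
  exact Finset.single_le_sum (fun i _ => hp.1 i) (Finset.mem_univ a)

theorem IsPMF.nonempty [Fintype α] {p : α → ℝ} (hp : IsPMF p) : Nonempty α := by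
  by_contra h
  rw [not_nonempty_iff] at h
  have := hp.2
  simp at this

theorem entFun_sub_le [Fintype α] {p q : α → ℝ} (hp : IsPMF p) (hq : IsPMF q) :
    (entFun p - entFun q) * Real.log 2 ≤ l1dist p q * Real.log (Fintype.card α) + 1 := by
  have hlog : Real.log 2 ≠ 0 := (Real.log_pos (by norm_num)).ne'
  have hent : ∀ p : α → ℝ, entFun p * Real.log 2 = ∑ a, Real.negMulLog (p a) := by
    intro p
    simp only [entFun, Real.logb, Real.negMulLog, neg_mul, Finset.sum_mul,
      Finset.sum_neg_distrib]
    congr 1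
    refine Finset.sum_congr rfl fun a _ => ?_
    field_simp
  have := hp.nonempty
  have hN : (0 : ℝ) < Fintype.card α := by exact_mod_cast Fintype.card_pos
  rw [sub_mul, hent, hent, ← Finset.sum_sub_distrib, l1dist, Finset.sum_mul]
  have hterm : ∀ a, Real.negMulLog (p a) - Real.negMulLog (q a) ≤
      |p a - q a| * Real.log (Fintype.card α) + 1 / Fintype.card α := by
    intro a
    refine (negMulLog_sub_le (hp.1 a) (hp.le_one a) (hq.1 a) (hq.le_one a)).trans ?_
    set d := |p a - q a|
    have hd : 0 ≤ d := abs_nonneg _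
    rcases hd.eq_or_lt with h | h
    · rw [← h]; simp
    have h4 := Real.log_le_sub_one_of_pos (show 0 < 1 / (Fintype.card α : ℝ) / d by positivity)
    rw [Real.log_div (by positivity) h.ne', Real.log_div one_ne_zero hN.ne', Real.log_one] at h4
    have h5 := mul_le_mul_of_nonneg_left h4 hd
    have h6 : d * (1 / (Fintype.card α : ℝ) / d - 1) = 1 / Fintype.card α - d := by
      field_simp
    rw [h6] at h5
    simp only [Real.negMulLog]
    linarith
  refine (Finset.sum_le_sum fun a _ => hterm a).trans ?_
  rw [Finset.sum_add_distrib]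
  simp

theorem l1dist_comm [Fintype α] (p q : α → ℝ) : l1dist p q = l1dist q p := by
  simp only [l1dist, abs_sub_comm]

theorem l1dist_distr_le [Fintype Ω] [Fintype α] [DecidableEq α] (μ ν : Ω → ℝ) (X : Ω → α) :
    l1dist (distr μ X) (distr ν X) ≤ l1dist μ ν := by
  have h := sum_distr_mul (fun ω => |μ ω - ν ω|) X (fun _ => 1)
  simp only [mul_one] at h
  rw [l1dist, l1dist, ← h]
  refine Finset.sum_le_sum fun a _ => ?_
  simp only [distr]
  rw [← Finset.sum_sub_distrib]
  refine (Finset.abs_sum_le_sum_abs _ _).trans (le_of_eq (Finset.sum_congr rfl fun ω _ => ?_))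
  split_ifs <;> simp

theorem H_sub_le [Fintype Ω] [Fintype α] [DecidableEq α] {μ ν : Ω → ℝ} (hμ : IsPMF μ)
    (hν : IsPMF ν) (X : Ω → α) :
    (H μ X - H ν X) * Real.log 2 ≤ l1dist μ ν * Real.log (Fintype.card α) + 1 := by
  have := (hμ.distr X).nonempty
  refine (entFun_sub_le (hμ.distr X) (hν.distr X)).trans ?_
  have h1 : 0 ≤ Real.log (Fintype.card α) :=
    Real.log_nonneg (by exact_mod_cast Fintype.card_pos)
  have := l1dist_distr_le μ ν X
  gcongr

theorem continuous_distr [Fintype Ω] [DecidableEq α] (X : Ω → α) (a : α) :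
    Continuous fun μ : Ω → ℝ => distr μ X a := by
  refine continuous_finsetSum _ fun ω _ => ?_
  split_ifs
  · exact continuous_apply ω
  · exact continuous_const

theorem continuous_H [Fintype Ω] [Fintype α] [DecidableEq α] (X : Ω → α) :
    Continuous fun μ : Ω → ℝ => H μ X := by
  have h : (fun μ : Ω → ℝ => H μ X) =
      fun μ => (∑ a, Real.negMulLog (distr μ X a)) / Real.log 2 := by
    funext μ
    simp only [H, entFun, Real.logb, Real.negMulLog, neg_mul, Finset.sum_neg_distrib,
      neg_div, Finset.sum_div, mul_div_assoc]
  rw [h]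
  exact (continuous_finsetSum _ fun a _ =>
    Real.continuous_negMulLog.comp (continuous_distr X a)).div_const _

theorem continuous_cmi [Fintype Ω] [Fintype α] [Fintype β] [Fintype γ]
    [DecidableEq α] [DecidableEq β] [DecidableEq γ] (A : Ω → α) (B : Ω → β) (Z : Ω → γ) :
    Continuous fun μ : Ω → ℝ => cmi μ A B Z :=
  (((continuous_H _).add (continuous_H _)).sub (continuous_H _)).sub (continuous_H _)

theorem isCompact_setOf_isPMF [Fintype Ω] : IsCompact {p : Ω → ℝ | IsPMF p} := by
  have : {p : Ω → ℝ | IsPMF p} = stdSimplex ℝ Ω := by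
    ext p; simp [IsPMF, stdSimplex]
  rw [this]
  exact isCompact_stdSimplex ℝ Ω

end Continuity

/-- The Markov chains of an interactive protocol with messages `F`, at the level of random
variables. -/
structure IsInteractive [Fintype Ω] [Fintype 𝒳₁] [DecidableEq 𝒳₁] [Fintype 𝒳₂] [DecidableEq 𝒳₂]
    [Fintype 𝒴₁] [DecidableEq 𝒴₁] [Fintype 𝒴₂] [DecidableEq 𝒴₂] {r : ℕ} {𝓕 : Fin r → Type}
    [∀ i, Fintype (𝓕 i)] [∀ i, DecidableEq (𝓕 i)] (μ : Ω → ℝ) (F : (i : Fin r) → Ω → 𝓕 i)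
    (X₁ : Ω → 𝒳₁) (X₂ : Ω → 𝒳₂) (Y₁ : Ω → 𝒴₁) (Y₂ : Ω → 𝒴₂) : Prop where
  odd : ∀ i : Fin r, (i : ℕ) % 2 = 0 → cmi μ (F i) X₂
    (fun ω => ((fun j : Fin (i : ℕ) => F ⟨j.1, j.2.trans i.2⟩ ω), X₁ ω)) = 0
  even : ∀ i : Fin r, (i : ℕ) % 2 = 1 → cmi μ (F i) X₁
    (fun ω => ((fun j : Fin (i : ℕ) => F ⟨j.1, j.2.trans i.2⟩ ω), X₂ ω)) = 0
  out₁ : cmi μ Y₁ (fun ω => (X₂ ω, Y₂ ω)) (fun ω => ((fun i => F i ω), X₁ ω)) = 0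
  out₂ : cmi μ Y₂ (fun ω => (X₁ ω, Y₁ ω)) (fun ω => ((fun i => F i ω), X₂ ω)) = 0

section Code

/-- The messages with index below `m`. -/
def pre {r : ℕ} {𝓒 : Fin r → Type} (C : (i : Fin r) → Ω → 𝓒 i) (m : ℕ) (ω : Ω) :
    (j : {j : Fin r // j.1 < m}) → 𝓒 j := fun j => C j ω

theorem pre_eq_iff {r : ℕ} {𝓒 : Fin r → Type} {C : (i : Fin r) → Ω → 𝓒 i} {m : ℕ} {ω ω' : Ω} :
    pre C m ω = pre C m ω' ↔ ∀ j : Fin r, j.1 < m → C j ω = C j ω' := by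
  simp [pre, funext_iff]

theorem prefix_eq_iff {r : ℕ} {𝓒 : Fin r → Type} {C : (i : Fin r) → Ω → 𝓒 i} {i : Fin r}
    {ω ω' : Ω} : ((fun j : Fin (i : ℕ) => C ⟨j.1, j.2.trans i.2⟩ ω) =
      fun j : Fin (i : ℕ) => C ⟨j.1, j.2.trans i.2⟩ ω') ↔
      ∀ j : Fin r, j.1 < i.1 → C j ω = C j ω' := by
  rw [funext_iff]
  exact ⟨fun h j hj => h ⟨j.1, hj⟩, fun h j => h ⟨j.1, j.2.trans i.2⟩ j.2⟩

/-- Pairs of source sequences with erased letters. -/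
def Masked (n : ℕ) (𝒳₁ 𝒳₂ : Type) : Type := Fin n → Option 𝒳₁ × Option 𝒳₂

instance (n : ℕ) [Fintype 𝒳₁] [Fintype 𝒳₂] : Fintype (Masked n 𝒳₁ 𝒳₂) :=
  inferInstanceAs (Fintype (Fin n → Option 𝒳₁ × Option 𝒳₂))

instance (n : ℕ) [DecidableEq 𝒳₁] [DecidableEq 𝒳₂] : DecidableEq (Masked n 𝒳₁ 𝒳₂) :=
  inferInstanceAs (DecidableEq (Fin n → Option 𝒳₁ × Option 𝒳₂))

/-- The source sequences with the letters outside the index sets `s` and `t` erased. -/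
def mask {n : ℕ} (X₁ : Ω → Fin n → 𝒳₁) (X₂ : Ω → Fin n → 𝒳₂) (s t : Fin n → Bool) (ω : Ω) :
    Masked n 𝒳₁ 𝒳₂ :=
  fun k => (if s k then some (X₁ ω k) else none, if t k then some (X₂ ω k) else none)

theorem mask_eq_iff {n : ℕ} {X₁ : Ω → Fin n → 𝒳₁} {X₂ : Ω → Fin n → 𝒳₂} {s t : Fin n → Bool}
    {ω ω' : Ω} : mask X₁ X₂ s t ω = mask X₁ X₂ s t ω' ↔
      (∀ k, s k = true → X₁ ω k = X₁ ω' k) ∧ (∀ k, t k = true → X₂ ω k = X₂ ω' k) := by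
  rw [show mask X₁ X₂ s t ω = mask X₁ X₂ s t ω' ↔ ∀ k, _ = _ from funext_iff]
  simp only [mask, Prod.mk.injEq, ← forall_and]
  refine forall_congr' fun k => ?_
  cases s k <;> cases t k <;> simp

variable [Fintype Ω] {μ : Ω → ℝ} {r : ℕ} {𝓒 : Fin r → Type}
  [∀ i, Fintype (𝓒 i)] [∀ i, DecidableEq (𝓒 i)]

/-- Interactive communication preserves conditional independence. -/
theorem cmi_pre_nonpos [Fintype α] [Fintype β] [Fintype γ]
    [DecidableEq α] [DecidableEq β] [DecidableEq γ] (hμ : ∀ ω, 0 ≤ μ ω)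
    {A : Ω → α} {B : Ω → β} {L : Ω → γ} {C : (i : Fin r) → Ω → 𝓒 i}
    (hodd : ∀ i : Fin r, (i : ℕ) % 2 = 0 → Det μ (C i) (fun ω => (pre C i ω, A ω)))
    (heven : ∀ i : Fin r, (i : ℕ) % 2 = 1 → Det μ (C i) (fun ω => (pre C i ω, B ω)))
    (h0 : cmi μ A B L ≤ 0) (m : ℕ) (hm : m ≤ r) :
    cmi μ A B (fun ω => (L ω, pre C m ω)) ≤ 0 := by
  induction m with
  | zero =>
    refine (cmi_mono hμ ?_ ?_ ?_ ?_).trans h0 <;> intro ω ω' _ _ e <;>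
      simp only [Prod.mk.injEq, pre_eq_iff] at e ⊢ <;> simp_all
  | succ m ih =>
    refine le_trans ?_ (ih (by omega))
    have hlt : m < r := by omega
    have hpre : ∀ ω ω', pre C (m + 1) ω = pre C (m + 1) ω' ↔
        pre C m ω = pre C m ω' ∧ C ⟨m, hlt⟩ ω = C ⟨m, hlt⟩ ω' := by
      intro ω ω'
      simp only [pre_eq_iff]
      refine ⟨fun h => ⟨fun j hj => h j (by omega), h _ (by simp)⟩, fun h j hj => ?_⟩
      rcases Nat.lt_succ_iff_lt_or_eq.1 hj with hj | hj
      · exact h.1 j hj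
      · have : j = ⟨m, hlt⟩ := Fin.ext hj
        subst this; exact h.2
    have hAB : (∀ ω ω', μ ω ≠ 0 → μ ω' ≠ 0 → pre C m ω = pre C m ω' → A ω = A ω' →
        C ⟨m, hlt⟩ ω = C ⟨m, hlt⟩ ω') ∨ (∀ ω ω', μ ω ≠ 0 → μ ω' ≠ 0 → pre C m ω = pre C m ω' →
        B ω = B ω' → C ⟨m, hlt⟩ ω = C ⟨m, hlt⟩ ω') := by
      rcases Nat.mod_two_eq_zero_or_one m with h | h
      · exact Or.inl fun ω ω' a b e e' => hodd ⟨m, hlt⟩ h ω ω' a b (Prod.ext e e')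
      · exact Or.inr fun ω ω' a b e e' => heven ⟨m, hlt⟩ h ω ω' a b (Prod.ext e e')
    have h3 : H μ (fun ω => (A ω, B ω, L ω, pre C (m + 1) ω)) =
        H μ (fun ω => (A ω, B ω, L ω, pre C m ω)) := by
      refine H_congr hμ ?_ ?_ <;> intro ω ω' a b e <;>
        simp only [Prod.mk.injEq, hpre] at e ⊢
      · rcases hAB with h | h
        · exact ⟨e.1, e.2.1, e.2.2.1, e.2.2.2, h ω ω' a b e.2.2.2 e.1⟩
        · exact ⟨e.1, e.2.1, e.2.2.1, e.2.2.2, h ω ω' a b e.2.2.2 e.2.1⟩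
      · tauto
    simp only [cmi]
    rcases hAB with h | h
    · have h1 : H μ (fun ω => (A ω, L ω, pre C (m + 1) ω)) =
          H μ (fun ω => (A ω, L ω, pre C m ω)) := by
        refine H_congr hμ ?_ ?_ <;> intro ω ω' a b e <;>
          simp only [Prod.mk.injEq, hpre] at e ⊢
        · exact ⟨e.1, e.2.1, e.2.2, h ω ω' a b e.2.2 e.1⟩
        · tauto
      have h2 := H_submod hμ (fun ω => (B ω, L ω, pre C m ω)) (fun ω => (L ω, pre C (m + 1) ω))
        (fun ω => (B ω, L ω, pre C (m + 1) ω)) (fun ω => (L ω, pre C m ω))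
        (by intro ω ω' a b e; simp only [Prod.mk.injEq] at e ⊢; tauto)
        (by intro ω ω' a b e; simp only [Prod.mk.injEq] at e ⊢; tauto)
        (by intro ω ω' a b e; simp only [Prod.mk.injEq, hpre] at e ⊢; tauto)
      linarith
    · have h1 : H μ (fun ω => (B ω, L ω, pre C (m + 1) ω)) =
          H μ (fun ω => (B ω, L ω, pre C m ω)) := by
        refine H_congr hμ ?_ ?_ <;> intro ω ω' a b e <;>
          simp only [Prod.mk.injEq, hpre] at e ⊢
        · exact ⟨e.1, e.2.1, e.2.2, h ω ω' a b e.2.2 e.1⟩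
        · tauto
      have h2 := H_submod hμ (fun ω => (A ω, L ω, pre C m ω)) (fun ω => (L ω, pre C (m + 1) ω))
        (fun ω => (A ω, L ω, pre C (m + 1) ω)) (fun ω => (L ω, pre C m ω))
        (by intro ω ω' a b e; simp only [Prod.mk.injEq] at e ⊢; tauto)
        (by intro ω ω' a b e; simp only [Prod.mk.injEq] at e ⊢; tauto)
        (by intro ω ω' a b e; simp only [Prod.mk.injEq, hpre] at e ⊢; tauto)
      linarith

/-- Messages determined by the past and side information `A` at the steps outside `P` contribute
entropy at the steps in `P` only. -/
theorem H_pre_le [Fintype α] [DecidableEq α] (hμ : IsPMF μ) {A : Ω → α}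
    {C : (i : Fin r) → Ω → 𝓒 i} (P : Fin r → Prop) [DecidablePred P]
    (hdet : ∀ i, ¬ P i → Det μ (C i) (fun ω => (pre C i ω, A ω))) :
    H μ (fun ω => ((fun i => C i ω), A ω)) ≤
      H μ A + ∑ i ∈ Finset.univ.filter P, H μ (C i) := by
  have key : ∀ m : ℕ, m ≤ r → H μ (fun ω => (pre C m ω, A ω)) ≤
      H μ A + ∑ i ∈ Finset.univ.filter (fun i : Fin r => P i ∧ i.1 < m), H μ (C i) := by
    intro m hm
    induction m with
    | zero =>
      simp only [not_lt_zero, and_false, Finset.filter_false, Finset.sum_empty, add_zero]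
      refine H_mono hμ.1 fun ω ω' _ _ e => ?_
      simp only [Prod.mk.injEq, pre_eq_iff]
      exact ⟨by simp, e⟩
    | succ m ih =>
      have hlt : m < r := by omega
      have ih := ih (by omega)
      by_cases hP : P ⟨m, hlt⟩
      · have h1 : Finset.univ.filter (fun i : Fin r => P i ∧ i.1 < m + 1) =
            insert ⟨m, hlt⟩ (Finset.univ.filter (fun i : Fin r => P i ∧ i.1 < m)) := by
          ext j
          simp only [Finset.mem_filter, Finset.mem_univ, true_and, Finset.mem_insert]
          constructor
          · rintro ⟨h1, h2⟩
            rcases Nat.lt_succ_iff_lt_or_eq.1 h2 with hj | hj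
            · exact Or.inr ⟨h1, hj⟩
            · exact Or.inl (Fin.ext hj)
          · rintro (rfl | h)
            · exact ⟨hP, by simp⟩
            · exact ⟨h.1, by omega⟩
        rw [h1, Finset.sum_insert (by simp)]
        have h2 := H_submod hμ.1 (fun ω => (pre C m ω, A ω)) (C ⟨m, hlt⟩)
          (fun ω => (pre C (m + 1) ω, A ω)) (fun _ => ())
          (by
            intro ω ω' a b e
            simp only [Prod.mk.injEq, pre_eq_iff] at e ⊢
            refine ⟨fun j hj => ?_, e.1.2⟩
            rcases Nat.lt_succ_iff_lt_or_eq.1 hj with hj | hj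
            · exact e.1.1 j hj
            · have : j = ⟨m, hlt⟩ := Fin.ext hj
              subst this; exact e.2)
          (fun _ _ _ _ _ => rfl) (fun _ _ _ _ _ => rfl)
        have h3 : H μ (fun _ => ()) = 0 := by
          rw [H_eq_sum]
          simp [distr, hμ.2]
        linarith
      · have h1 : Finset.univ.filter (fun i : Fin r => P i ∧ i.1 < m + 1) =
            Finset.univ.filter (fun i : Fin r => P i ∧ i.1 < m) := by
          ext j
          simp only [Finset.mem_filter, Finset.mem_univ, true_and]
          refine ⟨fun h => ⟨h.1, ?_⟩, fun h => ⟨h.1, by omega⟩⟩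
          rcases Nat.lt_succ_iff_lt_or_eq.1 h.2 with hj | hj
          · exact hj
          · have : j = ⟨m, hlt⟩ := Fin.ext hj
            subst this; exact absurd h.1 hP
        rw [h1]
        refine le_trans (H_mono hμ.1 ?_) ih
        intro ω ω' a b e
        have hd := hdet ⟨m, hlt⟩ hP ω ω' a b e
        simp only [Prod.mk.injEq, pre_eq_iff] at e ⊢
        refine ⟨fun j hj => ?_, e.2⟩
        rcases Nat.lt_succ_iff_lt_or_eq.1 hj with hj | hj
        · exact e.1 j hj
        · have : j = ⟨m, hlt⟩ := Fin.ext hj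
          subst this; exact hd
  have h := key r le_rfl
  simp only [Fin.is_lt, and_true] at h
  refine le_trans (H_mono hμ.1 ?_) h
  intro ω ω' _ _ e
  simp only [Prod.mk.injEq, funext_iff] at e ⊢
  exact ⟨fun j => e.1 ⟨j, j.2⟩, e.2⟩

end Code

section SingleLetter

/-- The hypotheses on a block code used in the single-letterization. -/
structure IsCode [Fintype Ω] {r n : ℕ} {𝓒 : Fin r → Type} {𝓜₁ 𝓜₂ : Type}
    [Fintype 𝒳₁] [DecidableEq 𝒳₁] [Fintype 𝒳₂] [DecidableEq 𝒳₂]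
    [Fintype 𝓜₁] [DecidableEq 𝓜₁] [Fintype 𝓜₂] [DecidableEq 𝓜₂]
    (μ : Ω → ℝ) (X₁ : Ω → Fin n → 𝒳₁) (X₂ : Ω → Fin n → 𝒳₂) (M₁ : Ω → 𝓜₁) (M₂ : Ω → 𝓜₂)
    (C : (i : Fin r) → Ω → 𝓒 i) (Y₁ : Ω → Fin n → 𝒴₁) (Y₂ : Ω → Fin n → 𝒴₂)
    (c : Bool → Bool → ℝ) : Prop where
  pmf : IsPMF μ
  source : ∀ s t, H μ (mask X₁ X₂ s t) = ∑ k, c (s k) (t k)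
  indep : H μ (fun ω => (M₁ ω, M₂ ω, X₁ ω, X₂ ω)) =
    H μ M₁ + H μ M₂ + H μ (fun ω => (X₁ ω, X₂ ω))
  odd : ∀ i : Fin r, (i : ℕ) % 2 = 0 → Det μ (C i) (fun ω => (pre C i ω, X₁ ω, M₁ ω))
  even : ∀ i : Fin r, (i : ℕ) % 2 = 1 → Det μ (C i) (fun ω => (pre C i ω, X₂ ω, M₂ ω))
  out₁ : Det μ Y₁ (fun ω => (X₁ ω, M₁ ω, fun i => C i ω))
  out₂ : Det μ Y₂ (fun ω => (X₂ ω, M₂ ω, fun i => C i ω))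

/-- The auxiliary variables of the letter `k`: every message is completed with the past of the first
source and the future of the second source. -/
def auxMsg {r n : ℕ} {𝓒 : Fin r → Type} (X₁ : Ω → Fin n → 𝒳₁) (X₂ : Ω → Fin n → 𝒳₂)
    (C : (i : Fin r) → Ω → 𝓒 i) (k : Fin n) (i : Fin r) (ω : Ω) :
    𝓒 i × Masked n 𝒳₁ 𝒳₂ :=
  (C i ω, mask X₁ X₂ (fun j => decide (j < k)) (fun j => decide (k < j)) ω)

section Iff

variable {r n : ℕ} {𝓒 : Fin r → Type} {X₁ : Ω → Fin n → 𝒳₁} {X₂ : Ω → Fin n → 𝒳₂}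
  {C : (i : Fin r) → Ω → 𝓒 i}

theorem auxMsg_prefix_iff {k : Fin n} {i : Fin r} {ω ω' : Ω} :
    ((fun j : Fin (i : ℕ) => auxMsg X₁ X₂ C k ⟨j.1, j.2.trans i.2⟩ ω) =
      fun j : Fin (i : ℕ) => auxMsg X₁ X₂ C k ⟨j.1, j.2.trans i.2⟩ ω') ↔
      pre C i ω = pre C i ω' ∧ (0 < i.1 → (∀ j, j < k → X₁ ω j = X₁ ω' j) ∧
        (∀ j, k < j → X₂ ω j = X₂ ω' j)) := by
  rw [prefix_eq_iff, pre_eq_iff]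
  simp only [auxMsg, Prod.mk.injEq, mask_eq_iff, decide_eq_true_eq]
  refine ⟨fun h => ⟨fun j hj => (h j hj).1, fun h0 => (h ⟨0, by omega⟩ h0).2⟩,
    fun h j hj => ⟨h.1 j hj, h.2 (by omega)⟩⟩

theorem auxMsg_all_iff (hr : 1 ≤ r) {k : Fin n} {ω ω' : Ω} :
    ((fun i => auxMsg X₁ X₂ C k i ω) = fun i => auxMsg X₁ X₂ C k i ω') ↔
      (∀ i, C i ω = C i ω') ∧ (∀ j, j < k → X₁ ω j = X₁ ω' j) ∧
        (∀ j, k < j → X₂ ω j = X₂ ω' j) := by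
  rw [funext_iff]
  simp only [auxMsg, Prod.mk.injEq, mask_eq_iff, decide_eq_true_eq, forall_and]
  exact ⟨fun h => ⟨h.1, h.2.1 ⟨0, hr⟩, h.2.2 ⟨0, hr⟩⟩, fun h => ⟨h.1, fun _ => h.2.1,
    fun _ => h.2.2⟩⟩

theorem mask_lt_succ_iff {k : Fin n} {ω ω' : Ω} :
    mask X₁ X₂ (fun j => decide (j.1 < k.1 + 1)) (fun j => decide (k.1 + 1 ≤ j.1)) ω =
    mask X₁ X₂ (fun j => decide (j.1 < k.1 + 1)) (fun j => decide (k.1 + 1 ≤ j.1)) ω' ↔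
      X₁ ω k = X₁ ω' k ∧ (∀ j, j < k → X₁ ω j = X₁ ω' j) ∧
        (∀ j, k < j → X₂ ω j = X₂ ω' j) := by
  simp only [mask_eq_iff, decide_eq_true_eq, Nat.lt_succ_iff, Nat.succ_le_iff,
    ← Fin.le_def, ← Fin.lt_def]
  refine ⟨fun h => ⟨h.1 k le_rfl, fun j hj => h.1 j hj.le, h.2⟩, fun h => ⟨fun j hj => ?_, h.2.2⟩⟩
  rcases hj.eq_or_lt with rfl | hj
  · exact h.1
  · exact h.2.1 j hj

theorem mask_le_iff {k : Fin n} {ω ω' : Ω} :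
    mask X₁ X₂ (fun j => decide (j.1 < k.1)) (fun j => decide (k.1 ≤ j.1)) ω =
    mask X₁ X₂ (fun j => decide (j.1 < k.1)) (fun j => decide (k.1 ≤ j.1)) ω' ↔
      X₂ ω k = X₂ ω' k ∧ (∀ j, j < k → X₁ ω j = X₁ ω' j) ∧
        (∀ j, k < j → X₂ ω j = X₂ ω' j) := by
  simp only [mask_eq_iff, decide_eq_true_eq, ← Fin.le_def, ← Fin.lt_def]
  refine ⟨fun h => ⟨h.2 k le_rfl, h.1, fun j hj => h.2 j hj.le⟩, fun h => ⟨h.2.1, fun j hj => ?_⟩⟩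
  rcases hj.eq_or_lt with rfl | hj
  · exact h.1
  · exact h.2.2 j hj

end Iff

variable [Fintype Ω] {μ : Ω → ℝ} {r n : ℕ} {𝓒 : Fin r → Type} {𝓜₁ 𝓜₂ : Type}
  [Fintype 𝒳₁] [DecidableEq 𝒳₁] [Fintype 𝒳₂] [DecidableEq 𝒳₂] [Fintype 𝓜₁] [DecidableEq 𝓜₁] [Fintype 𝓜₂] [DecidableEq 𝓜₂]
  {X₁ : Ω → Fin n → 𝒳₁} {X₂ : Ω → Fin n → 𝒳₂} {M₁ : Ω → 𝓜₁} {M₂ : Ω → 𝓜₂}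
  {C : (i : Fin r) → Ω → 𝓒 i} {Y₁ : Ω → Fin n → 𝒴₁} {Y₂ : Ω → Fin n → 𝒴₂}
  {c : Bool → Bool → ℝ}

theorem cmi_comm {α β γ : Type*} [Fintype α] [DecidableEq α] [Fintype β] [DecidableEq β]
    [Fintype γ] [DecidableEq γ] (hμ : IsPMF μ) (A : Ω → α) (B : Ω → β) (Z : Ω → γ) :
    cmi μ A B Z = cmi μ B A Z := by
  have e : H μ (fun ω => (A ω, B ω, Z ω)) = H μ (fun ω => (B ω, A ω, Z ω)) := by
    refine H_congr hμ.1 ?_ ?_ <;> intro ω ω' _ _ e <;>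
      simp only [Prod.mk.injEq] at e ⊢ <;> tauto
  rw [cmi, cmi, e]
  ring

theorem H_const_unit (hμ : IsPMF μ) : H μ (fun _ => ()) = 0 := by
  rw [H_eq_sum]
  simp [distr, hμ.2]

theorem H_le_add {α β δ : Type*} [Fintype α] [DecidableEq α] [Fintype β] [DecidableEq β]
    [Fintype δ] [DecidableEq δ] (hμ : IsPMF μ) (A : Ω → α) (B : Ω → β) (U : Ω → δ)
    (hU : Det μ U (fun ω => (A ω, B ω))) : H μ U ≤ H μ A + H μ B := by
  have := H_submod hμ.1 A B U (fun _ => ()) hU (fun _ _ _ _ _ => rfl) (fun _ _ _ _ _ => rfl)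
  rw [H_const_unit hμ] at this
  linarith

theorem IsCode.cmi_source (h : IsCode μ X₁ X₂ M₁ M₂ C Y₁ Y₂ c) (m : ℕ) :
    cmi μ (fun ω => (X₁ ω, M₁ ω)) (fun ω => (X₂ ω, M₂ ω))
      (mask X₁ X₂ (fun j => decide (j.1 < m)) (fun j => decide (m ≤ j.1))) ≤ 0 := by
  set L := mask X₁ X₂ (fun j => decide (j.1 < m)) (fun j => decide (m ≤ j.1)) with hL
  have h1 := H_le_add h.pmf M₁ (mask X₁ X₂ (fun _ => true) (fun j => decide (m ≤ j.1)))
    (fun ω => ((X₁ ω, M₁ ω), L ω)) (by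
      intro ω ω' _ _ e
      simp only [hL, Prod.mk.injEq, mask_eq_iff, decide_eq_true_eq] at e ⊢
      exact ⟨⟨funext fun k => e.2.1 k trivial, e.1⟩, fun k _ => e.2.1 k trivial, e.2.2⟩)
  have h2 := H_le_add h.pmf M₂ (mask X₁ X₂ (fun j => decide (j.1 < m)) (fun _ => true))
    (fun ω => ((X₂ ω, M₂ ω), L ω)) (by
      intro ω ω' _ _ e
      simp only [hL, Prod.mk.injEq, mask_eq_iff, decide_eq_true_eq] at e ⊢
      exact ⟨⟨funext fun k => e.2.2 k trivial, e.1⟩, e.2.1, fun k _ => e.2.2 k trivial⟩)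
  have h3 : H μ (fun ω => (M₁ ω, M₂ ω, X₁ ω, X₂ ω)) ≤
      H μ (fun ω => ((X₁ ω, M₁ ω), (X₂ ω, M₂ ω), L ω)) := H_mono h.pmf.1 (by
    intro ω ω' _ _ e
    simp only [Prod.mk.injEq] at e ⊢
    tauto)
  have h4 : H μ (mask X₁ X₂ (fun _ => true) (fun _ => true)) ≤ H μ (fun ω => (X₁ ω, X₂ ω)) :=
    H_mono h.pmf.1 (by
      intro ω ω' _ _ e
      simp only [Prod.mk.injEq, mask_eq_iff] at e ⊢
      exact ⟨fun k _ => by rw [e.1], fun k _ => by rw [e.2]⟩)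
  have h5 : H μ (mask X₁ X₂ (fun _ => true) (fun j => decide (m ≤ j.1))) +
      H μ (mask X₁ X₂ (fun j => decide (j.1 < m)) (fun _ => true)) =
      H μ (mask X₁ X₂ (fun _ => true) (fun _ => true)) + H μ L := by
    rw [hL, h.source, h.source, h.source, h.source, ← Finset.sum_add_distrib,
      ← Finset.sum_add_distrib]
    refine Finset.sum_congr rfl fun k _ => ?_
    by_cases hk : k.1 < m
    · simp [hk, not_le.2 hk, add_comm]
    · simp [hk, not_lt.1 hk]
  have h6 := h.indep
  rw [cmi]
  linarith

variable [∀ i, Fintype (𝓒 i)] [∀ i, DecidableEq (𝓒 i)]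

theorem IsCode.cmi_pre (h : IsCode μ X₁ X₂ M₁ M₂ C Y₁ Y₂ c) (m i : ℕ) (hi : i ≤ r) :
    cmi μ (fun ω => (X₁ ω, M₁ ω)) (fun ω => (X₂ ω, M₂ ω)) (fun ω =>
      (mask X₁ X₂ (fun j => decide (j.1 < m)) (fun j => decide (m ≤ j.1)) ω, pre C i ω)) ≤ 0 :=
  cmi_pre_nonpos h.pmf.1 h.odd h.even (h.cmi_source m) i hi

variable [Fintype 𝒴₁] [DecidableEq 𝒴₁] [Fintype 𝒴₂] [DecidableEq 𝒴₂]

theorem IsCode.isInteractive (h : IsCode μ X₁ X₂ M₁ M₂ C Y₁ Y₂ c) (hr : 1 ≤ r) (k : Fin n) :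
    IsInteractive μ (auxMsg X₁ X₂ C k) (fun ω => X₁ ω k) (fun ω => X₂ ω k)
      (fun ω => Y₁ ω k) (fun ω => Y₂ ω k) where
  odd i hi := by
    refine le_antisymm ?_ (cmi_nonneg h.pmf.1 _ _ _)
    have h1 := h.cmi_pre (k.1 + 1) i i.2.le
    have h2 : cmi μ (C i) (fun ω => X₂ ω k) (fun ω =>
      (mask X₁ X₂ (fun j => decide (j.1 < k.1 + 1)) (fun j => decide (k.1 + 1 ≤ j.1)) ω,
        pre C i ω)) ≤ 0 := by
      refine (cmi_mono h.pmf.1 ?_ ?_ ?_ ?_).trans h1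
      · intro ω ω' a b e
        have := h.odd i hi ω ω' a b
        simp only [Prod.mk.injEq] at *
        tauto
      · intro ω ω' a b e
        simp only [Prod.mk.injEq] at *
        rw [e.1.1]
      · exact fun _ _ _ _ => id
      · exact fun _ _ _ _ => id
    rcases Nat.eq_zero_or_pos i.1 with h0 | h0
    · have h3 : cmi μ (mask X₁ X₂ (fun j => decide (j < k)) (fun j => decide (k < j)))
          (fun ω => X₂ ω k) (fun ω => X₁ ω k) ≤ 0 := by
        have e1 : H μ (fun ω => (mask X₁ X₂ (fun j => decide (j < k))
            (fun j => decide (k < j)) ω, X₁ ω k)) =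
            H μ (mask X₁ X₂ (fun j => decide (j ≤ k)) (fun j => decide (k < j))) := by
          refine H_congr h.pmf.1 ?_ ?_ <;> intro ω ω' _ _ e <;>
            simp only [Prod.mk.injEq, mask_eq_iff, decide_eq_true_eq] at e ⊢
          · exact ⟨⟨fun j hj => e.1 j hj.le, e.2⟩, e.1 k le_rfl⟩
          · refine ⟨fun j hj => ?_, e.1.2⟩
            rcases hj.eq_or_lt with rfl | hj
            exacts [e.2, e.1.1 j hj]
        have e2 : H μ (fun ω => (X₂ ω k, X₁ ω k)) =
            H μ (mask X₁ X₂ (fun j => decide (j = k)) (fun j => decide (j = k))) := by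
          refine H_congr h.pmf.1 ?_ ?_ <;> intro ω ω' _ _ e <;>
            simp only [Prod.mk.injEq, mask_eq_iff, decide_eq_true_eq] at e ⊢
          · exact ⟨e.2 k rfl, e.1 k rfl⟩
          · exact ⟨fun j hj => hj ▸ e.2, fun j hj => hj ▸ e.1⟩
        have e3 : H μ (fun ω => X₁ ω k) =
            H μ (mask X₁ X₂ (fun j => decide (j = k)) (fun _ => false)) := by
          refine H_congr h.pmf.1 ?_ ?_ <;> intro ω ω' _ _ e <;>
            simp only [mask_eq_iff, decide_eq_true_eq] at e ⊢
          · exact e.1 k rfl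
          · exact ⟨fun j hj => hj ▸ e, by simp⟩
        have e4 : H μ (mask X₁ X₂ (fun j => decide (j ≤ k)) (fun j => decide (k ≤ j))) ≤
            H μ (fun ω => (mask X₁ X₂ (fun j => decide (j < k))
            (fun j => decide (k < j)) ω, X₂ ω k, X₁ ω k)) := by
          refine H_mono h.pmf.1 ?_
          intro ω ω' _ _ e
          simp only [Prod.mk.injEq, mask_eq_iff, decide_eq_true_eq] at e ⊢
          constructor
          · intro j hj
            rcases hj.eq_or_lt with rfl | hj
            exacts [e.2.2, e.1.1 j hj]
          · intro j hj
            rcases hj.eq_or_lt with rfl | hj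
            exacts [e.2.1, e.1.2 j hj]
        have e5 : H μ (mask X₁ X₂ (fun j => decide (j ≤ k)) (fun j => decide (k < j))) +
            H μ (mask X₁ X₂ (fun j => decide (j = k)) (fun j => decide (j = k))) =
            H μ (mask X₁ X₂ (fun j => decide (j ≤ k)) (fun j => decide (k ≤ j))) +
            H μ (mask X₁ X₂ (fun j => decide (j = k)) (fun _ => false)) := by
          rw [h.source, h.source, h.source, h.source, ← Finset.sum_add_distrib,
            ← Finset.sum_add_distrib]
          refine Finset.sum_congr rfl fun j _ => ?_
          rcases lt_trichotomy j k with hj | hj | hj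
          · simp [hj.le, hj.ne, not_lt.2 hj.le, not_le.2 hj]
          · subst hj; simp [add_comm]
          · simp [hj.le, hj.ne', hj, not_le.2 hj]
        rw [cmi]
        linarith
      set Z := mask X₁ X₂ (fun j => decide (j < k)) (fun j => decide (k < j)) with hZ
      have h4 : cmi μ (C i) (fun ω => X₂ ω k) (fun ω => (Z ω, X₁ ω k)) ≤ 0 := by
        refine (cmi_mono h.pmf.1 ?_ ?_ ?_ ?_).trans h2
        · exact fun _ _ _ _ e => (Prod.ext_iff.1 e).1
        · exact fun _ _ _ _ e => (Prod.ext_iff.1 e).1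
        · intro ω ω' a b e
          simp only [hZ, Prod.mk.injEq, mask_lt_succ_iff] at e ⊢
          simp only [mask_eq_iff, decide_eq_true_eq] at e ⊢
          tauto
        · intro ω ω' a b e
          simp only [hZ, Prod.mk.injEq, mask_lt_succ_iff] at e ⊢
          simp only [mask_eq_iff, decide_eq_true_eq, pre_eq_iff] at e ⊢
          exact ⟨by tauto, fun j hj => by omega⟩
      have h5 : cmi μ (auxMsg X₁ X₂ C k i) (fun ω => X₂ ω k) (fun ω => X₁ ω k) ≤ 0 := by
        have e1 : H μ (fun ω => (C i ω, X₂ ω k, Z ω, X₁ ω k)) ≤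
            H μ (fun ω => (auxMsg X₁ X₂ C k i ω, X₂ ω k, X₁ ω k)) := H_mono h.pmf.1 (by
          intro ω ω' a b e
          simp only [auxMsg, ← hZ, Prod.mk.injEq] at e ⊢
          tauto)
        have e2 : H μ (fun ω => (auxMsg X₁ X₂ C k i ω, X₁ ω k)) ≤
            H μ (fun ω => (C i ω, Z ω, X₁ ω k)) := H_mono h.pmf.1 (by
          intro ω ω' a b e
          simp only [auxMsg, ← hZ, Prod.mk.injEq] at e ⊢
          tauto)
        have e3 : H μ (fun ω => (X₂ ω k, Z ω, X₁ ω k)) = H μ (fun ω => (Z ω, X₂ ω k, X₁ ω k)) := by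
          refine H_congr h.pmf.1 ?_ ?_ <;> intro ω ω' _ _ e <;>
            simp only [Prod.mk.injEq] at e ⊢ <;> tauto
        rw [cmi] at h3 h4 ⊢
        linarith
      refine (cmi_mono h.pmf.1 ?_ ?_ ?_ ?_).trans h5
      · exact fun _ _ _ _ e => (Prod.ext_iff.1 e).1
      · exact fun _ _ _ _ e => (Prod.ext_iff.1 e).1
      · intro ω ω' a b e
        simp only [Prod.mk.injEq, auxMsg_prefix_iff, pre_eq_iff]
        exact ⟨⟨fun j hj => by omega, fun h' => by omega⟩, e⟩
      · exact fun _ _ _ _ e => (Prod.ext_iff.1 e).2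
    · refine (cmi_mono h.pmf.1 ?_ ?_ ?_ ?_).trans h2
      · intro ω ω' a b e
        simp only [auxMsg, Prod.mk.injEq, mask_lt_succ_iff] at e ⊢
        simp only [mask_eq_iff, decide_eq_true_eq] at e ⊢
        tauto
      · exact fun _ _ _ _ e => (Prod.ext_iff.1 e).1
      all_goals
        intro ω ω' a b e
        simp only [Prod.mk.injEq, auxMsg_prefix_iff, mask_lt_succ_iff] at e ⊢
        tauto
  even i hi := by
    refine le_antisymm ?_ (cmi_nonneg h.pmf.1 _ _ _)
    have h1 := h.cmi_pre k.1 i i.2.le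
    rw [cmi_comm h.pmf] at h1
    have h2 : cmi μ (C i) (fun ω => X₁ ω k) (fun ω =>
      (mask X₁ X₂ (fun j => decide (j.1 < k.1)) (fun j => decide (k.1 ≤ j.1)) ω,
        pre C i ω)) ≤ 0 := by
      refine (cmi_mono h.pmf.1 ?_ ?_ ?_ ?_).trans h1
      · intro ω ω' a b e
        have := h.even i hi ω ω' a b
        simp only [Prod.mk.injEq] at *
        tauto
      · intro ω ω' a b e
        simp only [Prod.mk.injEq] at *
        rw [e.1.1]
      · exact fun _ _ _ _ => id
      · exact fun _ _ _ _ => id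
    have h0 : 0 < i.1 := by omega
    refine (cmi_mono h.pmf.1 ?_ ?_ ?_ ?_).trans h2
    · intro ω ω' a b e
      simp only [auxMsg, Prod.mk.injEq, mask_le_iff] at e ⊢
      simp only [mask_eq_iff, decide_eq_true_eq] at e ⊢
      tauto
    · exact fun _ _ _ _ e => (Prod.ext_iff.1 e).1
    all_goals
      intro ω ω' a b e
      simp only [Prod.mk.injEq, auxMsg_prefix_iff, mask_le_iff] at e ⊢
      tauto
  out₁ := by
    refine le_antisymm ?_ (cmi_nonneg h.pmf.1 _ _ _)
    refine (cmi_mono h.pmf.1 ?_ ?_ ?_ ?_).trans (h.cmi_pre (k.1 + 1) r le_rfl)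
    · intro ω ω' a b e
      have := h.out₁ ω ω' a b
      simp only [Prod.mk.injEq, pre_eq_iff] at this e
      exact congrFun (this ⟨e.1.1, e.1.2, funext fun i => e.2.2 i i.2⟩) k
    · intro ω ω' a b e
      have := h.out₂ ω ω' a b
      simp only [Prod.mk.injEq, pre_eq_iff] at this e ⊢
      exact ⟨congrFun e.1.1 k, congrFun (this ⟨e.1.1, e.1.2, funext fun i => e.2.2 i i.2⟩) k⟩
    · intro ω ω' a b e
      simp only [Prod.mk.injEq, mask_lt_succ_iff, auxMsg_all_iff hr, pre_eq_iff] at e ⊢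
      exact ⟨⟨fun i => e.2 i i.2, e.1.2⟩, e.1.1⟩
    · intro ω ω' a b e
      simp only [Prod.mk.injEq, mask_lt_succ_iff, auxMsg_all_iff hr, pre_eq_iff] at e ⊢
      exact ⟨⟨e.2, e.1.2⟩, fun i _ => e.1.1 i⟩
  out₂ := by
    refine le_antisymm ?_ (cmi_nonneg h.pmf.1 _ _ _)
    have h1 := h.cmi_pre k.1 r le_rfl
    rw [cmi_comm h.pmf] at h1
    refine (cmi_mono h.pmf.1 ?_ ?_ ?_ ?_).trans h1
    · intro ω ω' a b e
      have := h.out₂ ω ω' a b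
      simp only [Prod.mk.injEq, pre_eq_iff] at this e
      exact congrFun (this ⟨e.1.1, e.1.2, funext fun i => e.2.2 i i.2⟩) k
    · intro ω ω' a b e
      have := h.out₁ ω ω' a b
      simp only [Prod.mk.injEq, pre_eq_iff] at this e ⊢
      exact ⟨congrFun e.1.1 k, congrFun (this ⟨e.1.1, e.1.2, funext fun i => e.2.2 i i.2⟩) k⟩
    · intro ω ω' a b e
      simp only [Prod.mk.injEq, mask_le_iff, auxMsg_all_iff hr, pre_eq_iff] at e ⊢
      exact ⟨⟨fun i => e.2 i i.2, e.1.2⟩, e.1.1⟩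
    · intro ω ω' a b e
      simp only [Prod.mk.injEq, mask_le_iff, auxMsg_all_iff hr, pre_eq_iff] at e ⊢
      exact ⟨⟨e.2, e.1.2⟩, fun i _ => e.1.1 i⟩

end SingleLetter
section Rates

variable [Fintype Ω] {μ : Ω → ℝ} {r n : ℕ} {𝓒 : Fin r → Type} {𝓜₁ 𝓜₂ : Type}
  [∀ i, Fintype (𝓒 i)] [∀ i, DecidableEq (𝓒 i)]
  [Fintype 𝒳₁] [DecidableEq 𝒳₁] [Fintype 𝒳₂] [DecidableEq 𝒳₂]
  [Fintype 𝓜₁] [DecidableEq 𝓜₁] [Fintype 𝓜₂] [DecidableEq 𝓜₂]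
  {X₁ : Ω → Fin n → 𝒳₁} {X₂ : Ω → Fin n → 𝒳₂} {M₁ : Ω → 𝓜₁} {M₂ : Ω → 𝓜₂}
  {C : (i : Fin r) → Ω → 𝓒 i} {Y₁ : Ω → Fin n → 𝒴₁} {Y₂ : Ω → Fin n → 𝒴₂}
  {c : Bool → Bool → ℝ}

theorem IsCode.sum_cmi_fst_le (h : IsCode μ X₁ X₂ M₁ M₂ C Y₁ Y₂ c) (hr : 1 ≤ r) :
    ∑ k, cmi μ (fun ω => X₁ ω k) (fun ω => fun i => auxMsg X₁ X₂ C k i ω) (fun ω => X₂ ω k) ≤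
      H μ (fun ω => (X₁ ω, X₂ ω)) - H μ X₂ -
        (H μ (fun ω => ((fun i => C i ω), X₁ ω, X₂ ω)) - H μ (fun ω => ((fun i => C i ω), X₂ ω))) := by
  set G : ℕ → ℝ := fun m => H μ (fun ω => ((fun i => C i ω),
    mask X₁ X₂ (fun j => decide (j.1 < m)) (fun _ => true) ω)) with hG
  have hstep : ∀ k : Fin n, cmi μ (fun ω => X₁ ω k) (fun ω => fun i => auxMsg X₁ X₂ C k i ω)
      (fun ω => X₂ ω k) ≤ (c true true - c false true) - (G (k.1 + 1) - G k.1) := by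
    intro k
    have e1 := H_submod h.pmf.1
      (fun ω => (X₁ ω k, (fun i => auxMsg X₁ X₂ C k i ω), X₂ ω k))
      (fun ω => ((fun i => C i ω), mask X₁ X₂ (fun j => decide (j.1 < k.1)) (fun _ => true) ω))
      (fun ω => ((fun i => C i ω), mask X₁ X₂ (fun j => decide (j.1 < k.1 + 1)) (fun _ => true) ω))
      (fun ω => ((fun i => auxMsg X₁ X₂ C k i ω), X₂ ω k))
      (by
        intro ω ω' _ _ e
        simp only [Prod.mk.injEq, mask_eq_iff, decide_eq_true_eq] at e ⊢
        refine ⟨e.2.1, fun j hj => ?_, e.2.2.2⟩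
        rcases Nat.lt_succ_iff_lt_or_eq.1 hj with hj | hj
        · exact e.2.2.1 j hj
        · rw [Fin.ext hj]; exact e.1.1)
      (by
        intro ω ω' _ _ e
        simp only [Prod.mk.injEq] at e ⊢
        exact e.2)
      (by
        intro ω ω' _ _ e
        simp only [Prod.mk.injEq, mask_eq_iff, decide_eq_true_eq] at e
        simp only [Prod.mk.injEq, auxMsg_all_iff hr]
        exact ⟨⟨congrFun e.1, e.2.1, fun j _ => e.2.2 j trivial⟩, e.2.2 k trivial⟩)
    have e2 : H μ (fun ω => (X₁ ω k, X₂ ω k)) =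
        H μ (mask X₁ X₂ (fun j => decide (j = k)) (fun j => decide (j = k))) := by
      refine H_congr h.pmf.1 ?_ ?_ <;> intro ω ω' _ _ e <;>
        simp only [Prod.mk.injEq, mask_eq_iff, decide_eq_true_eq] at e ⊢
      · exact ⟨e.1 k rfl, e.2 k rfl⟩
      · exact ⟨fun j hj => hj ▸ e.1, fun j hj => hj ▸ e.2⟩
    have e3 : H μ (fun ω => X₂ ω k) =
        H μ (mask X₁ X₂ (fun _ => false) (fun j => decide (j = k))) := by
      refine H_congr h.pmf.1 ?_ ?_ <;> intro ω ω' _ _ e <;>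
        simp only [mask_eq_iff, decide_eq_true_eq] at e ⊢
      · exact e.2 k rfl
      · exact ⟨by simp, fun j hj => hj ▸ e⟩
    have e4 : H μ (mask X₁ X₂ (fun j => decide (j = k)) (fun j => decide (j = k))) -
        H μ (mask X₁ X₂ (fun _ => false) (fun j => decide (j = k))) =
        c true true - c false true := by
      rw [h.source, h.source, ← Finset.sum_sub_distrib, Finset.sum_eq_single k]
      · simp
      · intro j _ hj; simp [hj]
      · simp
    rw [cmi]
    linarith
  refine (Finset.sum_le_sum fun k _ => hstep k).trans ?_
  rw [Finset.sum_sub_distrib, Fin.sum_univ_eq_sum_range (fun m => G (m + 1) - G m) n,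
    Finset.sum_range_sub]
  have f1 : H μ (fun ω => (X₁ ω, X₂ ω)) = H μ (mask X₁ X₂ (fun _ => true) (fun _ => true)) := by
    refine H_congr h.pmf.1 ?_ ?_ <;> intro ω ω' _ _ e <;>
      simp only [Prod.mk.injEq, mask_eq_iff] at e ⊢
    · exact ⟨funext fun k => e.1 k trivial, funext fun k => e.2 k trivial⟩
    · exact ⟨fun k _ => congrFun e.1 k, fun k _ => congrFun e.2 k⟩
  have f2 : H μ X₂ = H μ (mask X₁ X₂ (fun _ => false) (fun _ => true)) := by
    refine H_congr h.pmf.1 ?_ ?_ <;> intro ω ω' _ _ e <;>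
      simp only [mask_eq_iff] at e ⊢
    · exact funext fun k => e.2 k trivial
    · exact ⟨by simp, fun k _ => congrFun e k⟩
  have f3 : H μ (fun ω => ((fun i => C i ω), X₁ ω, X₂ ω)) ≤ G n := H_mono h.pmf.1 (by
    intro ω ω' _ _ e
    simp only [Prod.mk.injEq, mask_eq_iff, decide_eq_true_eq] at e ⊢
    exact ⟨e.1, funext fun k => e.2.1 k k.2, funext fun k => e.2.2 k trivial⟩)
  have f4 : G 0 ≤ H μ (fun ω => ((fun i => C i ω), X₂ ω)) := H_mono h.pmf.1 (by
    intro ω ω' _ _ e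
    simp only [Prod.mk.injEq, mask_eq_iff, decide_eq_true_eq] at e ⊢
    exact ⟨e.1, fun k hk => absurd hk (by simp), fun k _ => congrFun e.2 k⟩)
  rw [f1, f2, h.source, h.source, ← Finset.sum_sub_distrib]
  linarith

theorem IsCode.sum_cmi_snd_le (h : IsCode μ X₁ X₂ M₁ M₂ C Y₁ Y₂ c) (hr : 1 ≤ r) :
    ∑ k, cmi μ (fun ω => X₂ ω k) (fun ω => fun i => auxMsg X₁ X₂ C k i ω) (fun ω => X₁ ω k) ≤
      H μ (fun ω => (X₁ ω, X₂ ω)) - H μ X₁ -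
        (H μ (fun ω => ((fun i => C i ω), X₁ ω, X₂ ω)) - H μ (fun ω => ((fun i => C i ω), X₁ ω))) := by
  set G : ℕ → ℝ := fun m => H μ (fun ω => ((fun i => C i ω),
    mask X₁ X₂ (fun _ => true) (fun j => decide (m ≤ j.1)) ω)) with hG
  have hstep : ∀ k : Fin n, cmi μ (fun ω => X₂ ω k) (fun ω => fun i => auxMsg X₁ X₂ C k i ω)
      (fun ω => X₁ ω k) ≤ (c true true - c true false) + (G (k.1 + 1) - G k.1) := by
    intro k
    have e1 := H_submod h.pmf.1
      (fun ω => (X₂ ω k, (fun i => auxMsg X₁ X₂ C k i ω), X₁ ω k))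
      (fun ω => ((fun i => C i ω), mask X₁ X₂ (fun _ => true) (fun j => decide (k.1 + 1 ≤ j.1)) ω))
      (fun ω => ((fun i => C i ω), mask X₁ X₂ (fun _ => true) (fun j => decide (k.1 ≤ j.1)) ω))
      (fun ω => ((fun i => auxMsg X₁ X₂ C k i ω), X₁ ω k))
      (by
        intro ω ω' _ _ e
        simp only [Prod.mk.injEq, mask_eq_iff, decide_eq_true_eq] at e ⊢
        refine ⟨e.2.1, e.2.2.1, fun j hj => ?_⟩
        rcases hj.eq_or_lt with hj | hj
        · rw [← Fin.ext hj]; exact e.1.1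
        · exact e.2.2.2 j hj)
      (by
        intro ω ω' _ _ e
        simp only [Prod.mk.injEq] at e ⊢
        exact e.2)
      (by
        intro ω ω' _ _ e
        simp only [Prod.mk.injEq, mask_eq_iff, decide_eq_true_eq] at e
        simp only [Prod.mk.injEq, auxMsg_all_iff hr]
        exact ⟨⟨congrFun e.1, fun j _ => e.2.1 j trivial, e.2.2⟩, e.2.1 k trivial⟩)
    have e2 : H μ (fun ω => (X₂ ω k, X₁ ω k)) =
        H μ (mask X₁ X₂ (fun j => decide (j = k)) (fun j => decide (j = k))) := by
      refine H_congr h.pmf.1 ?_ ?_ <;> intro ω ω' _ _ e <;>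
        simp only [Prod.mk.injEq, mask_eq_iff, decide_eq_true_eq] at e ⊢
      · exact ⟨e.2 k rfl, e.1 k rfl⟩
      · exact ⟨fun j hj => hj ▸ e.2, fun j hj => hj ▸ e.1⟩
    have e3 : H μ (fun ω => X₁ ω k) =
        H μ (mask X₁ X₂ (fun j => decide (j = k)) (fun _ => false)) := by
      refine H_congr h.pmf.1 ?_ ?_ <;> intro ω ω' _ _ e <;>
        simp only [mask_eq_iff, decide_eq_true_eq] at e ⊢
      · exact e.1 k rfl
      · exact ⟨fun j hj => hj ▸ e, by simp⟩
    have e4 : H μ (mask X₁ X₂ (fun j => decide (j = k)) (fun j => decide (j = k))) -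
        H μ (mask X₁ X₂ (fun j => decide (j = k)) (fun _ => false)) =
        c true true - c true false := by
      rw [h.source, h.source, ← Finset.sum_sub_distrib, Finset.sum_eq_single k]
      · simp
      · intro j _ hj; simp [hj]
      · simp
    rw [cmi]
    linarith
  refine (Finset.sum_le_sum fun k _ => hstep k).trans ?_
  rw [Finset.sum_add_distrib, Fin.sum_univ_eq_sum_range (fun m => G (m + 1) - G m) n,
    Finset.sum_range_sub]
  have f1 : H μ (fun ω => (X₁ ω, X₂ ω)) = H μ (mask X₁ X₂ (fun _ => true) (fun _ => true)) := by
    refine H_congr h.pmf.1 ?_ ?_ <;> intro ω ω' _ _ e <;>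
      simp only [Prod.mk.injEq, mask_eq_iff] at e ⊢
    · exact ⟨funext fun k => e.1 k trivial, funext fun k => e.2 k trivial⟩
    · exact ⟨fun k _ => congrFun e.1 k, fun k _ => congrFun e.2 k⟩
  have f2 : H μ X₁ = H μ (mask X₁ X₂ (fun _ => true) (fun _ => false)) := by
    refine H_congr h.pmf.1 ?_ ?_ <;> intro ω ω' _ _ e <;>
      simp only [mask_eq_iff] at e ⊢
    · exact funext fun k => e.1 k trivial
    · exact ⟨fun k _ => congrFun e k, by simp⟩
  have f3 : H μ (fun ω => ((fun i => C i ω), X₁ ω, X₂ ω)) ≤ G 0 := H_mono h.pmf.1 (by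
    intro ω ω' _ _ e
    simp only [Prod.mk.injEq, mask_eq_iff, decide_eq_true_eq] at e ⊢
    exact ⟨e.1, funext fun k => e.2.1 k trivial, funext fun k => e.2.2 k (Nat.zero_le _)⟩)
  have f4 : G n ≤ H μ (fun ω => ((fun i => C i ω), X₁ ω)) := H_mono h.pmf.1 (by
    intro ω ω' _ _ e
    simp only [Prod.mk.injEq, mask_eq_iff, decide_eq_true_eq] at e ⊢
    exact ⟨e.1, fun k _ => congrFun e.2 k, fun k hk => absurd hk (by omega)⟩)
  rw [f1, f2, h.source, h.source, ← Finset.sum_sub_distrib]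
  linarith

variable [Fintype 𝒴₁] [DecidableEq 𝒴₁] [Fintype 𝒴₂] [DecidableEq 𝒴₂]

set_option synthInstance.maxSize 1000 in
set_option synthInstance.maxHeartbeats 200000 in
/-- The single-letter rates of a block code. -/
theorem IsCode.sum_rates_le (h : IsCode μ X₁ X₂ M₁ M₂ C Y₁ Y₂ c) (hr : 1 ≤ r) {R₁ R₂ : ℝ}
    (h₁ : ∑ i ∈ Finset.univ.filter (fun i : Fin r => (i : ℕ) % 2 = 0), H μ (C i) ≤ R₁)
    (h₂ : ∑ i ∈ Finset.univ.filter (fun i : Fin r => (i : ℕ) % 2 = 1), H μ (C i) ≤ R₂) :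
    ∑ k, cmi μ (fun ω => X₁ ω k) (fun ω => fun i => auxMsg X₁ X₂ C k i ω) (fun ω => X₂ ω k) ≤ R₁ ∧
    ∑ k, cmi μ (fun ω => X₂ ω k) (fun ω => fun i => auxMsg X₁ X₂ C k i ω) (fun ω => X₁ ω k) ≤ R₂ ∧
    ∑ k, cmi μ (fun ω => X₁ ω k) (fun ω => fun i => auxMsg X₁ X₂ C k i ω) (fun ω => X₂ ω k) +
    ∑ k, cmi μ (fun ω => X₂ ω k) (fun ω => fun i => auxMsg X₁ X₂ C k i ω) (fun ω => X₁ ω k) +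
      cmi μ Y₁ Y₂ (fun ω => (X₁ ω, X₂ ω)) ≤ R₁ + R₂ := by
  have a1 := h.sum_cmi_fst_le hr
  have a2 := h.sum_cmi_snd_le hr
  have p1 := H_pre_le h.pmf (A := fun ω => (X₂ ω, M₂ ω)) (C := C) (fun i => (i : ℕ) % 2 = 0)
    (fun i hi => h.even i (by omega))
  have p2 := H_pre_le h.pmf (A := fun ω => (X₁ ω, M₁ ω)) (C := C) (fun i => (i : ℕ) % 2 = 1)
    (fun i hi => h.odd i (by omega))
  have b1 := H_le_add h.pmf X₂ M₂ (fun ω => (X₂ ω, M₂ ω)) (fun _ _ _ _ => id)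
  have b2 := H_le_add h.pmf X₁ M₁ (fun ω => (X₁ ω, M₁ ω)) (fun _ _ _ _ => id)
  have s1 := H_submod h.pmf.1 (fun ω => ((fun i => C i ω), X₁ ω, X₂ ω))
    (fun ω => ((fun i => C i ω), X₂ ω, M₂ ω)) (fun ω => ((M₂ ω, fun i => C i ω), X₁ ω, X₂ ω))
    (fun ω => ((fun i => C i ω), X₂ ω))
    (by intro ω ω' _ _ e; simp only [Prod.mk.injEq] at e ⊢; tauto)
    (by intro ω ω' _ _ e; simp only [Prod.mk.injEq] at e ⊢; tauto)
    (by intro ω ω' _ _ e; simp only [Prod.mk.injEq] at e ⊢; tauto)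
  have s2 := H_submod h.pmf.1 (fun ω => ((fun i => C i ω), X₁ ω, X₂ ω))
    (fun ω => ((fun i => C i ω), X₁ ω, M₁ ω)) (fun ω => ((M₁ ω, fun i => C i ω), X₁ ω, X₂ ω))
    (fun ω => ((fun i => C i ω), X₁ ω))
    (by intro ω ω' _ _ e; simp only [Prod.mk.injEq] at e ⊢; tauto)
    (by intro ω ω' _ _ e; simp only [Prod.mk.injEq] at e ⊢; tauto)
    (by intro ω ω' _ _ e; simp only [Prod.mk.injEq] at e ⊢; tauto)
  have d1 := H_le_add h.pmf M₁ (fun ω => ((M₂ ω, fun i => C i ω), X₁ ω, X₂ ω))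
    (fun ω => (M₁ ω, M₂ ω, X₁ ω, X₂ ω))
    (by intro ω ω' _ _ e; simp only [Prod.mk.injEq] at e ⊢; tauto)
  have d2 := H_le_add h.pmf M₂ (fun ω => ((M₁ ω, fun i => C i ω), X₁ ω, X₂ ω))
    (fun ω => (M₁ ω, M₂ ω, X₁ ω, X₂ ω))
    (by intro ω ω' _ _ e; simp only [Prod.mk.injEq] at e ⊢; tauto)
  have y := cmi_mono h.pmf.1 (A' := Y₁) (B' := Y₂) (Z' := fun ω => (X₁ ω, X₂ ω))
    (A := fun ω => (M₁ ω, fun i => C i ω)) (B := fun ω => (M₂ ω, fun i => C i ω))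
    (Z := fun ω => (X₁ ω, X₂ ω))
    (by
      intro ω ω' a b e
      have := h.out₁ ω ω' a b
      simp only [Prod.mk.injEq] at e this
      tauto)
    (by
      intro ω ω' a b e
      have := h.out₂ ω ω' a b
      simp only [Prod.mk.injEq] at e this
      tauto)
    (fun _ _ _ _ => id) (fun _ _ _ _ => id)
  have d3 : H μ (fun ω => (M₁ ω, M₂ ω, X₁ ω, X₂ ω)) ≤ H μ (fun ω =>
      ((M₁ ω, fun i => C i ω), (M₂ ω, fun i => C i ω), (X₁ ω, X₂ ω))) := H_mono h.pmf.1
    (by intro ω ω' _ _ e; simp only [Prod.mk.injEq] at e ⊢; tauto)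
  have hi := h.indep
  conv_rhs at y => rw [cmi]
  refine ⟨?_, ?_, ?_⟩ <;> linarith

end Rates

section Reweight

variable [Fintype Ω] {μ ρ : Ω → ℝ}

theorem distr_mul_of_const [DecidableEq α] {X : Ω → α} {a : α} {c : ℝ}
    (h : ∀ ω, X ω = a → ρ ω = c) : distr (fun ω => ρ ω * μ ω) X a = c * distr μ X a := by
  simp only [distr, Finset.mul_sum]
  refine Finset.sum_congr rfl fun ω _ => ?_
  split_ifs with hω
  · rw [h ω hω]
  · simp

theorem distr_comp_eq_of_distr_eq [Fintype α] [DecidableEq α] [DecidableEq β] {ν : Ω → ℝ} {W : Ω → α} (h : distr ν W = distr μ W) (f : α → β) :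
    distr ν (fun ω => f (W ω)) = distr μ (fun ω => f (W ω)) := by
  rw [← distr_distr ν W, h, distr_distr]

section Triple

variable [Fintype α] [DecidableEq α] [Fintype β] [DecidableEq β] [Fintype γ] [DecidableEq γ]

theorem H_comp_eq_of_distr_eq {ν : Ω → ℝ} {W : Ω → α} (h : distr ν W = distr μ W) (f : α → β) :
    H ν (fun ω => f (W ω)) = H μ (fun ω => f (W ω)) := by
  rw [← H_distr ν W, h, H_distr]

theorem cmi_reweight_of_cond (hμ : ∀ ω, 0 ≤ μ ω) (hρ : ∀ ω, 0 ≤ ρ ω) {A : Ω → α} {B : Ω → β}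
    {Z : Ω → γ} (h : ∀ ω ω', Z ω = Z ω' → ρ ω = ρ ω') (h0 : cmi μ A B Z = 0) :
    cmi (fun ω => ρ ω * μ ω) A B Z = 0 := by
  rw [cmi_eq_zero_iff hμ] at h0
  rw [cmi_eq_zero_iff fun ω => mul_nonneg (hρ ω) (hμ ω)]
  intro a b z
  obtain ⟨c, hc⟩ : ∃ c, ∀ ω, Z ω = z → ρ ω = c := by
    by_cases hz : ∃ ω, Z ω = z
    · obtain ⟨ω', rfl⟩ := hz
      exact ⟨ρ ω', fun ω hω => h _ _ hω⟩
    · exact ⟨0, fun ω hω => absurd ⟨ω, hω⟩ hz⟩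
  rw [distr_mul_of_const (c := c), distr_mul_of_const (c := c), distr_mul_of_const (c := c),
    distr_mul_of_const (c := c)]
  · linear_combination c ^ 2 * h0 a b z
  all_goals
    intro ω hω
    first
    | exact hc ω hω
    | exact hc ω (by simp only [Prod.mk.injEq] at hω; tauto)

theorem cmi_reweight_of_left (hμ : ∀ ω, 0 ≤ μ ω) (hρ : ∀ ω, 0 ≤ ρ ω) {A : Ω → α} {B : Ω → β}
    {Z : Ω → γ} (h : ∀ ω ω', A ω = A ω' → Z ω = Z ω' → ρ ω = ρ ω')
    (hBZ : distr (fun ω => ρ ω * μ ω) (fun ω => (B ω, Z ω)) = distr μ (fun ω => (B ω, Z ω)))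
    (h0 : cmi μ A B Z = 0) : cmi (fun ω => ρ ω * μ ω) A B Z = 0 := by
  rw [cmi_eq_zero_iff hμ] at h0
  rw [cmi_eq_zero_iff fun ω => mul_nonneg (hρ ω) (hμ ω)]
  intro a b z
  obtain ⟨c, hc⟩ : ∃ c, ∀ ω, A ω = a → Z ω = z → ρ ω = c := by
    by_cases hz : ∃ ω, A ω = a ∧ Z ω = z
    · obtain ⟨ω', rfl, rfl⟩ := hz
      exact ⟨ρ ω', fun ω hω hω' => h _ _ hω hω'⟩
    · exact ⟨0, fun ω hω hω' => absurd ⟨ω, hω, hω'⟩ hz⟩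
  have hZ : distr (fun ω => ρ ω * μ ω) Z = distr μ Z :=
    distr_comp_eq_of_distr_eq hBZ Prod.snd
  rw [hBZ, hZ, distr_mul_of_const (c := c), distr_mul_of_const (c := c)]
  · linear_combination c * h0 a b z
  all_goals
    intro ω hω
    simp only [Prod.mk.injEq] at hω
    exact hc ω (by tauto) (by tauto)

theorem cmi_reweight_eq (hμ : ∀ ω, 0 ≤ μ ω) {B : Ω → α} {F : Ω → β} {A : Ω → γ}
    (h : ∀ ω ω', F ω = F ω' → ρ ω = ρ ω')
    (hBA : distr (fun ω => ρ ω * μ ω) (fun ω => (B ω, A ω)) = distr μ (fun ω => (B ω, A ω))) :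
    cmi (fun ω => ρ ω * μ ω) B F A = H μ (fun ω => (B ω, A ω)) - H μ A +
      ∑ ω, ρ ω * (μ ω * (Real.logb 2 (distr μ (fun ω => (B ω, F ω, A ω)) (B ω, F ω, A ω)) -
        Real.logb 2 (distr μ (fun ω => (F ω, A ω)) (F ω, A ω)))) := by
  have hA : H (fun ω => ρ ω * μ ω) A = H μ A := H_comp_eq_of_distr_eq hBA Prod.snd
  have hBA' : H (fun ω => ρ ω * μ ω) (fun ω => (B ω, A ω)) = H μ (fun ω => (B ω, A ω)) :=
    H_comp_eq_of_distr_eq hBA id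
  have key : ∑ ω, ρ ω * (μ ω * (Real.logb 2 (distr μ (fun ω => (B ω, F ω, A ω)) (B ω, F ω, A ω)) -
        Real.logb 2 (distr μ (fun ω => (F ω, A ω)) (F ω, A ω)))) =
      H (fun ω => ρ ω * μ ω) (fun ω => (F ω, A ω)) -
        H (fun ω => ρ ω * μ ω) (fun ω => (B ω, F ω, A ω)) := by
    rw [H_eq_sum, H_eq_sum, neg_sub_neg, ← Finset.sum_sub_distrib]
    refine Finset.sum_congr rfl fun ω _ => ?_
    by_cases h0 : ρ ω = 0
    · simp [h0]
    by_cases h1 : μ ω = 0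
    · simp [h1]
    have e1 : distr (fun ω => ρ ω * μ ω) (fun ω => (B ω, F ω, A ω)) (B ω, F ω, A ω) =
        ρ ω * distr μ (fun ω => (B ω, F ω, A ω)) (B ω, F ω, A ω) :=
      distr_mul_of_const fun ω' hω' => h _ _ (by simp only [Prod.mk.injEq] at hω'; tauto)
    have e2 : distr (fun ω => ρ ω * μ ω) (fun ω => (F ω, A ω)) (F ω, A ω) =
        ρ ω * distr μ (fun ω => (F ω, A ω)) (F ω, A ω) :=
      distr_mul_of_const fun ω' hω' => h _ _ (by simp only [Prod.mk.injEq] at hω'; tauto)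
    rw [e1, e2, Real.logb_mul h0 (distr_pos hμ (fun ω => (B ω, F ω, A ω)) h1).ne',
      Real.logb_mul h0 (distr_pos hμ (fun ω => (F ω, A ω)) h1).ne']
    ring
  rw [key, cmi, hA, hBA']
  ring

end Triple

variable {r : ℕ} {𝓕 : Fin r → Type} [∀ i, Fintype (𝓕 i)] [∀ i, DecidableEq (𝓕 i)]
  [Fintype 𝒳₁] [DecidableEq 𝒳₁] [Fintype 𝒳₂] [DecidableEq 𝒳₂]
  [Fintype 𝒴₁] [DecidableEq 𝒴₁] [Fintype 𝒴₂] [DecidableEq 𝒴₂]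
  {F : (i : Fin r) → Ω → 𝓕 i} {X₁ : Ω → 𝒳₁} {X₂ : Ω → 𝒳₂} {Y₁ : Ω → 𝒴₁} {Y₂ : Ω → 𝒴₂}

theorem IsInteractive.reweight (hμ : ∀ ω, 0 ≤ μ ω) (h : IsInteractive μ F X₁ X₂ Y₁ Y₂) (i : Fin r)
    (hρ : ∀ ω, 0 ≤ ρ ω)
    (hF : ∀ ω ω', pre F i ω = pre F i ω' → F i ω = F i ω' → ρ ω = ρ ω')
    (hV : distr (fun ω => ρ ω * μ ω) (fun ω => (pre F i ω, X₁ ω, X₂ ω, Y₁ ω, Y₂ ω)) =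
      distr μ (fun ω => (pre F i ω, X₁ ω, X₂ ω, Y₁ ω, Y₂ ω))) :
    IsInteractive (fun ω => ρ ω * μ ω) F X₁ X₂ Y₁ Y₂ where
  odd j hj := by
    rcases lt_trichotomy j i with hji | rfl | hij
    · rw [← h.odd j hj]
      have := cmi_distr (fun ω => ρ ω * μ ω) (fun ω => (pre F i ω, X₁ ω, X₂ ω, Y₁ ω, Y₂ ω))
        (fun w => w.1 ⟨j, hji⟩) (fun w => w.2.2.1)
        (fun w => ((fun k : Fin (j : ℕ) => w.1 ⟨⟨k.1, k.2.trans j.2⟩, k.2.trans hji⟩), w.2.1))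
      rw [hV, cmi_distr] at this
      exact this.symm
    · refine cmi_reweight_of_left hμ hρ ?_ ?_ (h.odd j hj)
      · intro ω ω' e e'
        simp only [Prod.mk.injEq, prefix_eq_iff] at e'
        exact hF ω ω' (pre_eq_iff.2 e'.1) e
      · exact distr_comp_eq_of_distr_eq hV (fun w => (w.2.2.1,
          ((fun k : Fin (j : ℕ) => w.1 ⟨⟨k.1, k.2.trans j.2⟩, k.2⟩), w.2.1)))
    · refine cmi_reweight_of_cond hμ hρ ?_ (h.odd j hj)
      intro ω ω' e
      simp only [Prod.mk.injEq, prefix_eq_iff] at e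
      exact hF ω ω' (pre_eq_iff.2 fun k hk => e.1 k (hk.trans hij)) (e.1 i hij)
  even j hj := by
    rcases lt_trichotomy j i with hji | rfl | hij
    · rw [← h.even j hj]
      have := cmi_distr (fun ω => ρ ω * μ ω) (fun ω => (pre F i ω, X₁ ω, X₂ ω, Y₁ ω, Y₂ ω))
        (fun w => w.1 ⟨j, hji⟩) (fun w => w.2.1)
        (fun w => ((fun k : Fin (j : ℕ) => w.1 ⟨⟨k.1, k.2.trans j.2⟩, k.2.trans hji⟩), w.2.2.1))
      rw [hV, cmi_distr] at this
      exact this.symm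
    · refine cmi_reweight_of_left hμ hρ ?_ ?_ (h.even j hj)
      · intro ω ω' e e'
        simp only [Prod.mk.injEq, prefix_eq_iff] at e'
        exact hF ω ω' (pre_eq_iff.2 e'.1) e
      · exact distr_comp_eq_of_distr_eq hV (fun w => (w.2.1,
          ((fun k : Fin (j : ℕ) => w.1 ⟨⟨k.1, k.2.trans j.2⟩, k.2⟩), w.2.2.1)))
    · refine cmi_reweight_of_cond hμ hρ ?_ (h.even j hj)
      intro ω ω' e
      simp only [Prod.mk.injEq, prefix_eq_iff] at e
      exact hF ω ω' (pre_eq_iff.2 fun k hk => e.1 k (hk.trans hij)) (e.1 i hij)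
  out₁ := by
    refine cmi_reweight_of_cond hμ hρ ?_ h.out₁
    intro ω ω' e
    simp only [Prod.mk.injEq] at e
    exact hF ω ω' (pre_eq_iff.2 fun k _ => congrFun e.1 k) (congrFun e.1 i)
  out₂ := by
    refine cmi_reweight_of_cond hμ hρ ?_ h.out₂
    intro ω ω' e
    simp only [Prod.mk.injEq] at e
    exact hF ω ω' (pre_eq_iff.2 fun k _ => congrFun e.1 k) (congrFun e.1 i)

end Reweight

section Split

variable [Fintype Ω] {μ : Ω → ℝ}

theorem exists_relation [Fintype α] [DecidableEq α] [Fintype β] [DecidableEq β] [DecidableEq γ]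
    {A : Ω → β} {Z : Ω → γ} {V : Ω → α} {z : γ}
    (hcard : Fintype.card α <
      (Finset.univ.filter fun f => distr μ (fun ω => (A ω, Z ω)) (f, z) ≠ 0).card) :
    ∃ c : β → ℝ, (∀ v, ∑ f, c f * distr μ (fun ω => (A ω, Z ω, V ω)) (f, z, v) = 0) ∧
      (∀ f, c f ≠ 0 → ∃ ω, μ ω ≠ 0 ∧ A ω = f ∧ Z ω = z) ∧ ∃ f, c f ≠ 0 := by
  classical
  set S := Finset.univ.filter fun f => distr μ (fun ω => (A ω, Z ω)) (f, z) ≠ 0 with hS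
  have hdep : ¬ LinearIndependent ℝ
      (fun (f : S) (v : α) => distr μ (fun ω => (A ω, Z ω, V ω)) (f.1, z, v)) := by
    intro h
    have := h.fintype_card_le_finrank
    simp only [Fintype.card_coe, Module.finrank_fintype_fun_eq_card] at this
    omega
  obtain ⟨g, hg, f₀, hf₀⟩ := Fintype.not_linearIndependent_iff.1 hdep
  refine ⟨fun f => if hf : f ∈ S then g ⟨f, hf⟩ else 0, fun v => ?_, fun f hf => ?_, f₀, ?_⟩
  · have := congrFun hg v
    simp only [Finset.sum_apply, Pi.smul_apply, smul_eq_mul, Pi.zero_apply] at this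
    rw [← Finset.sum_subset (Finset.subset_univ S) fun f _ hf => by simp [hf],
      ← Finset.sum_attach]
    exact (Finset.sum_congr (by rfl) fun f _ => by simp [f.2]).trans this
  · have hfS : f ∈ S := by
      by_contra h
      simp [h] at hf
    have h1 := (Finset.mem_filter.1 hfS).2
    obtain ⟨ω, -, hω⟩ := Finset.exists_ne_zero_of_sum_ne_zero h1
    simp only [Prod.mk.injEq, ne_eq, ite_eq_right_iff, Classical.not_imp] at hω
    exact ⟨ω, hω.2, hω.1⟩
  · simpa using hf₀

theorem exists_reweight [Fintype α] [DecidableEq α] [Fintype β] [DecidableEq β] [DecidableEq γ]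
    (hμ : ∀ ω, 0 ≤ μ ω) {A : Ω → β} {Z : Ω → γ} {V : Ω → α} {z : γ} {c : β → ℝ}
    (hc : ∀ v, ∑ f, c f * distr μ (fun ω => (A ω, Z ω, V ω)) (f, z, v) = 0)
    (hS : ∀ f, c f ≠ 0 → ∃ ω, μ ω ≠ 0 ∧ A ω = f ∧ Z ω = z) (hne : ∃ f, c f ≠ 0) :
    ∃ M : ℝ, 0 < M ∧ (∀ ω, 0 ≤ 1 - (if Z ω = z then c (A ω) else 0) / M) ∧
      (∃ ω, μ ω ≠ 0 ∧ 1 - (if Z ω = z then c (A ω) else 0) / M = 0) ∧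
      distr (fun ω => (1 - (if Z ω = z then c (A ω) else 0) / M) * μ ω) (fun ω => (Z ω, V ω)) =
        distr μ (fun ω => (Z ω, V ω)) := by
  have hpos : ∃ f, 0 < c f := by
    by_contra! hle
    have hsum : ∑ f, c f * distr μ (fun ω => (A ω, Z ω)) (f, z) = 0 := by
      have h1 : ∀ f, distr μ (fun ω => (A ω, Z ω)) (f, z) =
          ∑ v, distr μ (fun ω => (A ω, Z ω, V ω)) (f, z, v) := by
        intro f
        have := sum_distr_pair_left μ V (fun ω => (A ω, Z ω)) (f, z)
        rw [← this]
        refine Finset.sum_congr rfl fun v _ => ?_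
        simp only [distr, Prod.mk.injEq]
        exact Finset.sum_congr rfl fun ω _ => if_congr (by tauto) rfl rfl
      simp only [h1, Finset.mul_sum]
      rw [Finset.sum_comm]
      exact Finset.sum_eq_zero fun v _ => hc v
    rw [Finset.sum_eq_zero_iff_of_nonpos fun f _ =>
      mul_nonpos_of_nonpos_of_nonneg (hle f) (distr_nonneg hμ _ _)] at hsum
    obtain ⟨f, hf⟩ := hne
    obtain ⟨ω, hω, rfl, rfl⟩ := hS f hf
    have := distr_pos hμ (fun ω => (A ω, Z ω)) hω
    rcases mul_eq_zero.1 (hsum (A ω) (Finset.mem_univ _)) with h | h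
    · exact hf h
    · exact this.ne' h
  obtain ⟨f, hf⟩ := hpos
  obtain ⟨f₁, -, hf₁⟩ := Finset.exists_max_image Finset.univ c ⟨f, Finset.mem_univ _⟩
  have hM : 0 < c f₁ := hf.trans_le (hf₁ f (Finset.mem_univ _))
  refine ⟨c f₁, hM, fun ω => ?_, ?_, ?_⟩
  · rw [sub_nonneg, div_le_one hM]
    split_ifs
    · exact hf₁ _ (Finset.mem_univ _)
    · exact hM.le
  · obtain ⟨ω, hω, h1, h2⟩ := hS f₁ hM.ne'
    exact ⟨ω, hω, by rw [if_pos h2, h1, div_self hM.ne', sub_self]⟩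
  · funext ⟨z', v⟩
    have h0 : ∑ ω, (if (Z ω, V ω) = (z', v) then (if Z ω = z then c (A ω) else 0) * μ ω else 0) =
        0 := by
      by_cases hz : z' = z
      · subst hz
        refine Eq.trans ?_ (hc v)
        simp only [distr, Finset.mul_sum]
        rw [Finset.sum_comm]
        refine Finset.sum_congr rfl fun ω _ => ?_
        by_cases h : Z ω = z' ∧ V ω = v
        · simp [h.1, h.2]
        · simp [h]
      · refine Finset.sum_eq_zero fun ω _ => ?_
        by_cases h : Z ω = z
        · have : z ≠ z' := fun h' => hz h'.symm
          simp [h, this]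
        · simp [h]
    have h1 : distr (fun ω => (1 - (if Z ω = z then c (A ω) else 0) / c f₁) * μ ω)
        (fun ω => (Z ω, V ω)) (z', v) = distr μ (fun ω => (Z ω, V ω)) (z', v) -
        (∑ ω, (if (Z ω, V ω) = (z', v) then (if Z ω = z then c (A ω) else 0) * μ ω else 0)) /
          c f₁ := by
      simp only [distr]
      rw [Finset.sum_div, ← Finset.sum_sub_distrib]
      refine Finset.sum_congr rfl fun ω _ => ?_
      by_cases h : (Z ω, V ω) = (z', v)
      · simp only [h, if_true]
        ring
      · simp only [h, if_false]
        ring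
    rw [h1, h0, zero_div, sub_zero]

theorem exists_split [Fintype α] [DecidableEq α] [Fintype β] [DecidableEq β] [DecidableEq γ]
    (hμ : ∀ ω, 0 ≤ μ ω) {A : Ω → β} {Z : Ω → γ} (V : Ω → α) {z : γ}
    (hcard : Fintype.card α <
      (Finset.univ.filter fun f => distr μ (fun ω => (A ω, Z ω)) (f, z) ≠ 0).card) :
    ∃ (a : Fin 2 → ℝ) (ρ : Fin 2 → Ω → ℝ), (∀ s, 0 ≤ a s) ∧ ∑ s, a s = 1 ∧
      (∀ ω, ∑ s, a s * ρ s ω = 1) ∧ ∀ s, (∀ ω, 0 ≤ ρ s ω) ∧ (∃ ω, μ ω ≠ 0 ∧ ρ s ω = 0) ∧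
      (∀ ω ω', Z ω = Z ω' → A ω = A ω' → ρ s ω = ρ s ω') ∧
      distr (fun ω => ρ s ω * μ ω) (fun ω => (Z ω, V ω)) = distr μ (fun ω => (Z ω, V ω)) := by
  obtain ⟨c, hc, hS, f, hf⟩ := exists_relation (V := V) hcard
  obtain ⟨M, hM, h1, h2, h3⟩ := exists_reweight hμ hc hS ⟨f, hf⟩
  obtain ⟨N, hN, k1, k2, k3⟩ := exists_reweight hμ (c := fun f => - c f) (z := z) (A := A) (Z := Z)
    (V := V) (fun v => by simp [hc v]) (fun f hf => hS f (by simpa using hf))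
    ⟨f, by simpa using hf⟩
  refine ⟨![M / (M + N), N / (M + N)],
    ![fun ω => 1 - (if Z ω = z then c (A ω) else 0) / M,
      fun ω => 1 - (if Z ω = z then - c (A ω) else 0) / N], ?_, ?_, ?_, ?_⟩
  · intro s
    fin_cases s <;> simp <;> positivity
  · simp only [Fin.sum_univ_two, Matrix.cons_val_zero, Matrix.cons_val_one]
    field_simp
  · intro ω
    simp only [Fin.sum_univ_two, Matrix.cons_val_zero, Matrix.cons_val_one]
    split_ifs <;> field_simp <;> ring
  · intro s
    fin_cases s
    · exact ⟨h1, h2, fun ω ω' e e' => by simp [e, e'], h3⟩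
    · exact ⟨k1, k2, fun ω ω' e e' => by simp [e, e'], k3⟩

end Split

section Reduction

variable [Fintype Ω] {μ : Ω → ℝ}
variable {r : ℕ} {𝓕 : Fin r → Type} [∀ i, Fintype (𝓕 i)] [∀ i, DecidableEq (𝓕 i)]
  [Fintype 𝒳₁] [DecidableEq 𝒳₁] [Fintype 𝒳₂] [DecidableEq 𝒳₂]
  [Fintype 𝒴₁] [DecidableEq 𝒴₁] [Fintype 𝒴₂] [DecidableEq 𝒴₂]
  {F : (i : Fin r) → Ω → 𝓕 i} {X₁ : Ω → 𝒳₁} {X₂ : Ω → 𝒳₂} {Y₁ : Ω → 𝒴₁} {Y₂ : Ω → 𝒴₂}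

theorem IsInteractive.relabel {𝓖 : Fin r → Type} [∀ i, Fintype (𝓖 i)] [∀ i, DecidableEq (𝓖 i)]
    {G : (i : Fin r) → Ω → 𝓖 i} (hμ : ∀ ω, 0 ≤ μ ω) (h : IsInteractive μ F X₁ X₂ Y₁ Y₂)
    (hFG : ∀ ω ω', μ ω ≠ 0 → μ ω' ≠ 0 → ∀ m : ℕ, (∀ j : Fin r, j.1 < m → F j ω = F j ω') ↔
      ∀ j : Fin r, j.1 < m → G j ω = G j ω') : IsInteractive μ G X₁ X₂ Y₁ Y₂ := by
  have hall : ∀ ω ω', μ ω ≠ 0 → μ ω' ≠ 0 → ((fun i => F i ω) = (fun i => F i ω') ↔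
      (fun i => G i ω) = fun i => G i ω') := by
    intro ω ω' a b
    simpa [funext_iff] using hFG ω ω' a b r
  have hsucc : ∀ ω ω', μ ω ≠ 0 → μ ω' ≠ 0 → ∀ i : Fin r,
      ((F i ω = F i ω' ∧ ∀ j : Fin r, j.1 < i.1 → F j ω = F j ω') ↔
      (G i ω = G i ω' ∧ ∀ j : Fin r, j.1 < i.1 → G j ω = G j ω')) := by
    intro ω ω' a b i
    have aux : ∀ {𝓗 : Fin r → Type} (K : (i : Fin r) → Ω → 𝓗 i),
        (K i ω = K i ω' ∧ ∀ j : Fin r, j.1 < i.1 → K j ω = K j ω') ↔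
        ∀ j : Fin r, j.1 < i.1 + 1 → K j ω = K j ω' := by
      intro 𝓗 K
      refine ⟨fun h j hj => ?_, fun h => ⟨h i (Nat.lt_succ_self _), fun j hj => h j (by omega)⟩⟩
      rcases Nat.lt_succ_iff_lt_or_eq.1 hj with hj | hj
      · exact h.2 j hj
      · rw [Fin.ext hj]; exact h.1
    rw [aux F, aux G]
    exact hFG ω ω' a b _
  refine ⟨fun i hi => ?_, fun i hi => ?_, ?_, ?_⟩
  · rw [← h.odd i hi]
    refine cmi_congr hμ ?_ ?_ ?_ ?_ ?_ ?_ <;> intro ω ω' a b <;>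
      have e1 := hFG ω ω' a b i <;> have e2 := hsucc ω ω' a b i <;>
      simp only [Prod.mk.injEq, prefix_eq_iff] <;> tauto
  · rw [← h.even i hi]
    refine cmi_congr hμ ?_ ?_ ?_ ?_ ?_ ?_ <;> intro ω ω' a b <;>
      have e1 := hFG ω ω' a b i <;> have e2 := hsucc ω ω' a b i <;>
      simp only [Prod.mk.injEq, prefix_eq_iff] <;> tauto
  · rw [← h.out₁]
    refine cmi_congr hμ ?_ ?_ ?_ ?_ ?_ ?_ <;> intro ω ω' a b <;>
      have e1 := hall ω ω' a b <;> simp only [Prod.mk.injEq] <;> tauto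
  · rw [← h.out₂]
    refine cmi_congr hμ ?_ ?_ ?_ ?_ ?_ ?_ <;> intro ω ω' a b <;>
      have e1 := hall ω ω' a b <;> simp only [Prod.mk.injEq] <;> tauto

theorem exists_relabel {D : ℕ} (hD : 0 < D) (hcard : ∀ (i : Fin r) z, (Finset.univ.filter fun f =>
      distr μ (fun ω => (F i ω, pre F i ω)) (f, z) ≠ 0).card ≤ D) (hμ : ∀ ω, 0 ≤ μ ω) :
    ∃ G : Fin r → Ω → Fin D, ∀ ω ω', μ ω ≠ 0 → μ ω' ≠ 0 → ∀ m : ℕ,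
      (∀ j : Fin r, j.1 < m → F j ω = F j ω') ↔ ∀ j : Fin r, j.1 < m → G j ω = G j ω' := by
  classical
  have hex : ∀ (i : Fin r) z, ∃ e : 𝓕 i → Fin D, ∀ f f',
      distr μ (fun ω => (F i ω, pre F i ω)) (f, z) ≠ 0 →
      distr μ (fun ω => (F i ω, pre F i ω)) (f', z) ≠ 0 → e f = e f' → f = f' := by
    intro i z
    have h := hcard i z
    set S := Finset.univ.filter fun f => distr μ (fun ω => (F i ω, pre F i ω)) (f, z) ≠ 0 with hS
    obtain ⟨e⟩ := Function.Embedding.nonempty_of_card_le (α := S) (β := Fin D) (by simpa using h)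
    refine ⟨fun f => if hf : f ∈ S then e ⟨f, hf⟩ else ⟨0, hD⟩, fun f f' hf hf' heq => ?_⟩
    have h1 : f ∈ S := by simpa [hS] using hf
    have h2 : f' ∈ S := by simpa [hS] using hf'
    simp only [h1, h2, dif_pos] at heq
    simpa using e.injective heq
  choose e he using hex
  refine ⟨fun i ω => e i (pre F i ω) (F i ω), fun ω ω' a b m => ?_⟩
  constructor
  · intro h j hj
    have h1 : pre F j ω = pre F j ω' := pre_eq_iff.2 fun k hk => h k (hk.trans hj)
    change e j (pre F j ω) (F j ω) = e j (pre F j ω') (F j ω')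
    rw [h1, h j hj]
  · intro h j
    induction j using WellFoundedLT.induction with
    | ind j ih =>
      intro hj
      have h1 : pre F j ω = pre F j ω' := pre_eq_iff.2 fun k hk => ih k hk (lt_trans hk hj)
      have h2 := h j hj
      simp only [h1] at h2
      have p1 := distr_pos hμ (fun ω => (F j ω, pre F j ω)) a
      have p2 := distr_pos hμ (fun ω => (F j ω, pre F j ω)) b
      simp only [h1] at p1
      exact he j _ _ _ p1.ne' p2.ne' h2

/-- The rate pairs realised with arbitrary auxiliary alphabets are convex combinations of those
realised with auxiliary alphabets of the size of the target alphabet. -/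
theorem IsInteractive.rates_mem {K : Set (ℝ × ℝ)} (hK : Convex ℝ K)
    {v : 𝒳₁ × 𝒳₂ × 𝒴₁ × 𝒴₂ → ℝ}
    (hmem : ∀ (ν : Ω → ℝ) (G : Fin r → Ω → Fin (Fintype.card (𝒳₁ × 𝒳₂ × 𝒴₁ × 𝒴₂))), IsPMF ν →
      IsInteractive ν G X₁ X₂ Y₁ Y₂ → distr ν (fun ω => (X₁ ω, X₂ ω, Y₁ ω, Y₂ ω)) = v →
      (cmi ν X₁ (fun ω => fun i => G i ω) X₂, cmi ν X₂ (fun ω => fun i => G i ω) X₁) ∈ K)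
    (hμ : IsPMF μ) (h : IsInteractive μ F X₁ X₂ Y₁ Y₂)
    (hv : distr μ (fun ω => (X₁ ω, X₂ ω, Y₁ ω, Y₂ ω)) = v) :
    (cmi μ X₁ (fun ω => fun i => F i ω) X₂, cmi μ X₂ (fun ω => fun i => F i ω) X₁) ∈ K := by
  classical
  induction hN : (Finset.univ.filter fun ω => μ ω ≠ 0).card using Nat.strong_induction_on
    generalizing μ with
  | _ N ih =>
  by_cases hcard : ∀ (i : Fin r) z, (Finset.univ.filter fun f =>
      distr μ (fun ω => (F i ω, pre F i ω)) (f, z) ≠ 0).card ≤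
        Fintype.card (𝒳₁ × 𝒳₂ × 𝒴₁ × 𝒴₂)
  · have hD : 0 < Fintype.card (𝒳₁ × 𝒳₂ × 𝒴₁ × 𝒴₂) :=
      have := (hμ.distr (fun ω => (X₁ ω, X₂ ω, Y₁ ω, Y₂ ω))).nonempty
      Fintype.card_pos
    obtain ⟨G, hG⟩ := exists_relabel hD hcard hμ.1
    have hall : ∀ ω ω', μ ω ≠ 0 → μ ω' ≠ 0 → ((fun i => F i ω) = (fun i => F i ω') ↔
        (fun i => G i ω) = fun i => G i ω') := by
      intro ω ω' a b
      simpa [funext_iff] using hG ω ω' a b r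
    have e1 : cmi μ X₁ (fun ω => fun i => G i ω) X₂ = cmi μ X₁ (fun ω => fun i => F i ω) X₂ := by
      refine cmi_congr hμ.1 ?_ ?_ ?_ ?_ ?_ ?_ <;> intro ω ω' a b <;>
        have e1 := hall ω ω' a b <;> try simp only [Prod.mk.injEq]
      all_goals tauto
    have e2 : cmi μ X₂ (fun ω => fun i => G i ω) X₁ = cmi μ X₂ (fun ω => fun i => F i ω) X₁ := by
      refine cmi_congr hμ.1 ?_ ?_ ?_ ?_ ?_ ?_ <;> intro ω ω' a b <;>
        have e1 := hall ω ω' a b <;> try simp only [Prod.mk.injEq]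
      all_goals tauto
    rw [← e1, ← e2]
    exact hmem μ G hμ (h.relabel hμ.1 hG) hv
  · push Not at hcard
    obtain ⟨i, z, hcard⟩ := hcard
    obtain ⟨a, ρ, ha, hasum, haρ, hρ⟩ :=
      exists_split hμ.1 (fun ω => (X₁ ω, X₂ ω, Y₁ ω, Y₂ ω)) hcard
    have hFρ : ∀ s ω ω', (fun i => F i ω) = (fun i => F i ω') → ρ s ω = ρ s ω' :=
      fun s ω ω' e => (hρ s).2.2.1 ω ω' (pre_eq_iff.2 fun j _ => congrFun e j) (congrFun e i)
    have hsum : ∀ g : Ω → ℝ, ∑ s, a s * ∑ ω, ρ s ω * g ω = ∑ ω, g ω := by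
      intro g
      simp only [Finset.mul_sum]
      rw [Finset.sum_comm]
      refine Finset.sum_congr rfl fun ω _ => ?_
      calc ∑ s, a s * (ρ s ω * g ω) = (∑ s, a s * ρ s ω) * g ω := by
            rw [Finset.sum_mul]
            exact Finset.sum_congr rfl fun s _ => by ring
        _ = g ω := by rw [haρ, one_mul]
    have hcmi : ∀ {β γ : Type} [Fintype β] [DecidableEq β] [Fintype γ] [DecidableEq γ]
        (B : Ω → β) (A : Ω → γ), (∀ s, distr (fun ω => ρ s ω * μ ω) (fun ω => (B ω, A ω)) =
          distr μ (fun ω => (B ω, A ω))) → cmi μ B (fun ω => fun i => F i ω) A =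
          ∑ s, a s * cmi (fun ω => ρ s ω * μ ω) B (fun ω => fun i => F i ω) A := by
      intro β γ _ _ _ _ B A hBA
      have h1 := cmi_reweight_eq (ρ := fun _ => 1) (B := B) (A := A) (F := fun ω => fun i => F i ω)
        hμ.1 (fun _ _ _ => rfl) (by simp)
      simp only [one_mul] at h1
      rw [h1]
      simp only [fun s => cmi_reweight_eq hμ.1 (hFρ s) (hBA s), mul_add, Finset.sum_add_distrib,
        hsum, ← Finset.sum_mul, hasum, one_mul]
    have hcomp := fun s {β : Type} [DecidableEq β] (f : _ → β) =>
      distr_comp_eq_of_distr_eq (hρ s).2.2.2 f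
    rw [hcmi X₁ X₂ fun s => hcomp s (fun w => (w.2.1, w.2.2.1)),
      hcmi X₂ X₁ fun s => hcomp s (fun w => (w.2.2.1, w.2.1))]
    have := hK.sum_mem (t := Finset.univ) (w := a) (z := fun s =>
      (cmi (fun ω => ρ s ω * μ ω) X₁ (fun ω => fun i => F i ω) X₂,
        cmi (fun ω => ρ s ω * μ ω) X₂ (fun ω => fun i => F i ω) X₁)) (fun s _ => ha s) hasum
      (fun s _ => by
        have hVs := hcomp s (fun w => w.2)
        refine ih _ ?_ ⟨fun ω => mul_nonneg ((hρ s).1 ω) (hμ.1 ω), ?_⟩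
          (h.reweight hμ.1 i (hρ s).1 (hρ s).2.2.1 (hρ s).2.2.2) (hVs.trans hv) rfl
        · rw [← hN]
          refine Finset.card_lt_card ((Finset.ssubset_iff_of_subset fun ω hω => ?_).2 ?_)
          · simp only [Finset.mem_filter, Finset.mem_univ, true_and] at hω ⊢
            exact right_ne_zero_of_mul hω
          · obtain ⟨ω, hω, hω'⟩ := (hρ s).2.1
            exact ⟨ω, by simpa using hω, by simp [hω']⟩
        · rw [← sum_distr _ (fun ω => (X₁ ω, X₂ ω, Y₁ ω, Y₂ ω)), hVs, sum_distr, hμ.2])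
    convert this using 1
    simp

end Reduction

section Block

variable [Fintype Ω] {μ : Ω → ℝ} {n : ℕ}

theorem distr_equiv [DecidableEq α] [DecidableEq β] (μ : Ω → ℝ) (X : Ω → α) (e : α ≃ β) :
    distr μ (fun ω => e (X ω)) = fun b => distr μ X (e.symm b) := by
  funext b
  simp only [distr, Equiv.eq_symm_apply]

theorem distr_id [Fintype α] [DecidableEq α] (p : α → ℝ) : distr p (fun a => a) = p := by
  funext a
  simp [distr]

theorem IsPMF.pi [Fintype α] {p : α → ℝ} (hp : IsPMF p) :
    IsPMF (fun w : Fin n → α => ∏ k, p (w k)) := by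
  classical
  refine ⟨fun w => Finset.prod_nonneg fun k _ => hp.1 _, ?_⟩
  have h := Finset.prod_univ_sum (fun _ : Fin n => (Finset.univ : Finset α)) (fun _ a => p a)
  simp only [Fintype.piFinset_univ, hp.2, Finset.prod_const_one] at h
  exact h.symm

theorem entFun_prod [Fintype α] [Fintype β] {p : α → ℝ} {s : β → ℝ} (hp : ∑ a, p a = 1)
    (hs : ∑ b, s b = 1) : entFun (fun m : α × β => p m.1 * s m.2) = entFun p + entFun s := by
  have h : ∀ a b, p a * s b * Real.logb 2 (p a * s b) =
      p a * Real.logb 2 (p a) * s b + p a * (s b * Real.logb 2 (s b)) := by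
    intro a b
    by_cases ha : p a = 0
    · simp [ha]
    by_cases hb : s b = 0
    · simp [hb]
    rw [Real.logb_mul ha hb]
    ring
  simp only [entFun, Fintype.sum_prod_type, h, Finset.sum_add_distrib, ← Finset.mul_sum, hs,
    ← Finset.sum_mul, hp]
  ring

theorem H_prod [Fintype α] [DecidableEq α] [Fintype β] [DecidableEq β] {X : Ω → α} {Y : Ω → β}
    {p : α → ℝ} {s : β → ℝ} (hp : ∑ a, p a = 1)
    (hs : ∑ b, s b = 1) (h : distr μ (fun ω => (X ω, Y ω)) = fun m => p m.1 * s m.2) :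
    H μ (fun ω => (X ω, Y ω)) = entFun p + entFun s := by
  rw [H, h, entFun_prod hp hs]

theorem abs_H_block_sub_le [Fintype α] [DecidableEq α] [Fintype β] [DecidableEq β] (hμ : IsPMF μ)
    {q : α → ℝ} (hq : IsPMF q) {X : Ω → Fin n → α} {ε : ℝ}
    (h : l1dist (distr μ X) (fun w => ∏ k, q (w k)) ≤ ε) (g : α → β) :
    |H μ (fun ω k => g (X ω k)) - n * H q g| * Real.log 2 ≤
      ε * n * Real.log (Fintype.card β) + 1 := by
  have h1 : H (fun w : Fin n → α => ∏ k, q (w k)) (fun w k => g (w k)) = n * H q g := by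
    rw [H_pi (W := fun w => w) hq.2 (distr_id _) fun _ => g]
    simp
  have h2 : H μ (fun ω k => g (X ω k)) = H (distr μ X) (fun w k => g (w k)) :=
    (H_distr μ X fun w k => g (w k)).symm
  have hβ := (hq.distr g).nonempty
  have hlog : Real.log (Fintype.card (Fin n → β)) = n * Real.log (Fintype.card β) := by
    simp
  have hL : 0 ≤ n * Real.log (Fintype.card β) :=
    mul_nonneg (Nat.cast_nonneg n) (Real.log_nonneg (by exact_mod_cast Fintype.card_pos))
  have k1 := H_sub_le (hμ.distr X) (hq.pi (n := n)) (fun w k => g (w k))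
  have k2 := H_sub_le (hq.pi (n := n)) (hμ.distr X) (fun w k => g (w k))
  rw [l1dist_comm] at k2
  rw [hlog] at k1 k2
  have k3 := mul_le_mul_of_nonneg_right h hL
  rw [h2, ← h1, ← abs_of_pos (Real.log_pos one_lt_two), ← abs_mul, abs_le]
  constructor <;> nlinarith

theorem cmi_block_ge {α β γ δ : Type*} [Fintype α] [DecidableEq α] [Fintype β] [DecidableEq β]
    [Fintype γ] [DecidableEq γ] [Fintype δ] [DecidableEq δ] (hμ : IsPMF μ)
    {q : α → ℝ} (hq : IsPMF q) {X : Ω → Fin n → α} {ε : ℝ}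
    (h : l1dist (distr μ X) (fun w => ∏ k, q (w k)) ≤ ε) (A : α → β) (B : α → γ) (Z : α → δ) :
    (n * cmi q A B Z - cmi μ (fun ω k => A (X ω k)) (fun ω k => B (X ω k))
      (fun ω k => Z (X ω k))) * Real.log 2 ≤
      ε * n * (Real.log (Fintype.card (β × δ)) + Real.log (Fintype.card (γ × δ)) +
        Real.log (Fintype.card (β × γ × δ)) + Real.log (Fintype.card δ)) + 4 := by
  have h1 := abs_H_block_sub_le hμ hq h (fun a => (A a, Z a))
  have h2 := abs_H_block_sub_le hμ hq h (fun a => (B a, Z a))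
  have h3 := abs_H_block_sub_le hμ hq h (fun a => (A a, B a, Z a))
  have h4 := abs_H_block_sub_le hμ hq h Z
  have e1 : H μ (fun ω => ((fun k => A (X ω k)), fun k => Z (X ω k))) =
      H μ (fun ω k => (A (X ω k), Z (X ω k))) := by
    refine H_congr hμ.1 ?_ ?_ <;> intro ω ω' _ _ e <;> simpa [funext_iff, forall_and] using e
  have e2 : H μ (fun ω => ((fun k => B (X ω k)), fun k => Z (X ω k))) =
      H μ (fun ω k => (B (X ω k), Z (X ω k))) := by
    refine H_congr hμ.1 ?_ ?_ <;> intro ω ω' _ _ e <;> simpa [funext_iff, forall_and] using e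
  have e3 : H μ (fun ω => ((fun k => A (X ω k)), (fun k => B (X ω k)), fun k => Z (X ω k))) =
      H μ (fun ω k => (A (X ω k), B (X ω k), Z (X ω k))) := by
    refine H_congr hμ.1 ?_ ?_ <;> intro ω ω' _ _ e <;> simpa [funext_iff, forall_and] using e
  have hl := Real.log_pos one_lt_two
  have aux : ∀ {x b : ℝ}, |x| * Real.log 2 ≤ b → x * Real.log 2 ≤ b ∧ -x * Real.log 2 ≤ b :=
    fun {x b} hx => ⟨(mul_le_mul_of_nonneg_right (le_abs_self x) hl.le).trans hx,
      (mul_le_mul_of_nonneg_right (neg_le_abs x) hl.le).trans hx⟩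
  rw [cmi, cmi, e1, e2, e3]
  linarith [(aux h1).2, (aux h2).2, (aux h3).1, (aux h4).1]

end Block

section Letters

theorem sum_srcMarg [Fintype 𝒳₁] [Fintype 𝒳₂] [Fintype 𝒴₁] [Fintype 𝒴₂]
    (q : 𝒳₁ × 𝒳₂ × 𝒴₁ × 𝒴₂ → ℝ) : ∑ x, srcMarg q x = ∑ a, q a := by
  simp only [srcMarg, Fintype.sum_prod_type]

variable {n : ℕ}

/-- Blocks of quadruples as quadruples of blocks. -/
def lettersEquiv (n : ℕ) (𝒳₁ 𝒳₂ 𝒴₁ 𝒴₂ : Type) :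
    (Fin n → 𝒳₁) × (Fin n → 𝒳₂) × (Fin n → 𝒴₁) × (Fin n → 𝒴₂) ≃
      (Fin n → 𝒳₁ × 𝒳₂ × 𝒴₁ × 𝒴₂) where
  toFun a k := (a.1 k, a.2.1 k, a.2.2.1 k, a.2.2.2 k)
  invFun w := (fun k => (w k).1, fun k => (w k).2.1, fun k => (w k).2.2.1, fun k => (w k).2.2.2)
  left_inv _ := rfl
  right_inv _ := rfl

variable [Fintype Ω] {μ : Ω → ℝ}
  [Fintype 𝒳₁] [DecidableEq 𝒳₁] [Fintype 𝒳₂] [DecidableEq 𝒳₂]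
  [Fintype 𝒴₁] [DecidableEq 𝒴₁] [Fintype 𝒴₂] [DecidableEq 𝒴₂]
  {X₁ : Ω → Fin n → 𝒳₁} {X₂ : Ω → Fin n → 𝒳₂} {Y₁ : Ω → Fin n → 𝒴₁} {Y₂ : Ω → Fin n → 𝒴₂}
  {q : 𝒳₁ × 𝒳₂ × 𝒴₁ × 𝒴₂ → ℝ}

theorem l1dist_letters :
    l1dist (distr μ (fun ω k => (X₁ ω k, X₂ ω k, Y₁ ω k, Y₂ ω k))) (fun w => ∏ k, q (w k)) =
      l1dist (distr μ (fun ω => (X₁ ω, X₂ ω, Y₁ ω, Y₂ ω)))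
        (fun a => ∏ k, q (a.1 k, a.2.1 k, a.2.2.1 k, a.2.2.2 k)) := by
  have h := distr_equiv μ (fun ω => (X₁ ω, X₂ ω, Y₁ ω, Y₂ ω)) (lettersEquiv n 𝒳₁ 𝒳₂ 𝒴₁ 𝒴₂)
  have h' : distr μ (fun ω k => (X₁ ω k, X₂ ω k, Y₁ ω k, Y₂ ω k)) = fun b =>
    distr μ (fun ω => (X₁ ω, X₂ ω, Y₁ ω, Y₂ ω)) ((lettersEquiv n 𝒳₁ 𝒳₂ 𝒴₁ 𝒴₂).symm b) := h
  rw [h', l1dist, l1dist, ← Equiv.sum_comp (lettersEquiv n 𝒳₁ 𝒳₂ 𝒴₁ 𝒴₂).symm]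
  rfl

theorem l1dist_letter_le (hq : IsPMF q) (k : Fin n) :
    l1dist (distr μ (fun ω => (X₁ ω k, X₂ ω k, Y₁ ω k, Y₂ ω k))) q ≤
      l1dist (distr μ (fun ω => (X₁ ω, X₂ ω, Y₁ ω, Y₂ ω)))
        (fun a => ∏ k, q (a.1 k, a.2.1 k, a.2.2.1 k, a.2.2.2 k)) := by
  rw [← l1dist_letters]
  refine le_trans (le_of_eq ?_) (l1dist_distr_le _ _ fun w => w k)
  rw [distr_distr, distr_pi_eval (W := fun w => w) hq.2 (distr_id _) k]

theorem isCode_of_admissible {r : ℕ} {𝓒 : Fin r → Type} {𝓜₁ 𝓜₂ : Type}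
    [∀ i, Fintype (𝓒 i)] [∀ i, DecidableEq (𝓒 i)]
    [Fintype 𝓜₁] [DecidableEq 𝓜₁] [Fintype 𝓜₂] [DecidableEq 𝓜₂]
    {M₁ : Ω → 𝓜₁} {M₂ : Ω → 𝓜₂} {C : (i : Fin r) → Ω → 𝓒 i} (hq : IsPMF q) (hμ : IsPMF μ)
    (hsrc : distr μ (fun ω => (X₁ ω, X₂ ω)) = fun x => ∏ k, srcMarg q (x.1 k, x.2 k))
    (hind : distr μ (fun ω => (M₁ ω, M₂ ω, X₁ ω, X₂ ω)) =
      fun m => distr μ M₁ m.1 * distr μ M₂ m.2.1 * distr μ (fun ω => (X₁ ω, X₂ ω)) m.2.2)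
    (hodd : ∀ i : Fin r, (i : ℕ) % 2 = 0 → condEnt μ (C i)
      (fun ω => ((fun j : Fin (i : ℕ) => C ⟨j.1, j.2.trans i.2⟩ ω), X₁ ω, M₁ ω)) = 0)
    (heven : ∀ i : Fin r, (i : ℕ) % 2 = 1 → condEnt μ (C i)
      (fun ω => ((fun j : Fin (i : ℕ) => C ⟨j.1, j.2.trans i.2⟩ ω), X₂ ω, M₂ ω)) = 0)
    (hout₁ : condEnt μ Y₁ (fun ω => (X₁ ω, M₁ ω, fun i : Fin r => C i ω)) = 0)
    (hout₂ : condEnt μ Y₂ (fun ω => (X₂ ω, M₂ ω, fun i : Fin r => C i ω)) = 0) :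
    IsCode μ X₁ X₂ M₁ M₂ C Y₁ Y₂ fun s t =>
      H (srcMarg q) (fun x => (if s then some x.1 else none, if t then some x.2 else none)) where
  pmf := hμ
  source s t := by
    have h : distr μ (fun ω k => (X₁ ω k, X₂ ω k)) = fun w => ∏ k, srcMarg q (w k) := by
      have h := distr_equiv μ (fun ω => (X₁ ω, X₂ ω))
        (Equiv.arrowProdEquivProdArrow (Fin n) (fun _ => 𝒳₁) (fun _ => 𝒳₂)).symm
      rw [hsrc] at h
      exact h
    exact H_pi (by rw [sum_srcMarg, hq.2]) h fun k x =>
      (if s k then some x.1 else none, if t k then some x.2 else none)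
  indep := by
    have h1 : ∑ m : 𝓜₂ × (Fin n → 𝒳₁) × (Fin n → 𝒳₂),
        distr μ M₂ m.1 * distr μ (fun ω => (X₁ ω, X₂ ω)) m.2 = 1 := by
      rw [Fintype.sum_prod_type]
      simp only [← Finset.mul_sum, sum_distr, hμ.2, mul_one]
    rw [H_prod (p := distr μ M₁) (s := fun m => distr μ M₂ m.1 *
      distr μ (fun ω => (X₁ ω, X₂ ω)) m.2) (by rw [sum_distr, hμ.2]) h1
      (by rw [hind]; funext m; ring), entFun_prod (by rw [sum_distr, hμ.2])
      (by rw [sum_distr, hμ.2])]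
    simp only [H]
    ring
  odd i hi ω ω' a b e := by
    refine det_of_condEnt_eq_zero hμ.1 (hodd i hi) ω ω' a b ?_
    simpa only [Prod.mk.injEq, prefix_eq_iff, pre_eq_iff] using e
  even i hi ω ω' a b e := by
    refine det_of_condEnt_eq_zero hμ.1 (heven i hi) ω ω' a b ?_
    simpa only [Prod.mk.injEq, prefix_eq_iff, pre_eq_iff] using e
  out₁ := det_of_condEnt_eq_zero hμ.1 hout₁
  out₂ := det_of_condEnt_eq_zero hμ.1 hout₂

end Letters

section Limit

variable [Fintype 𝒳₁] [DecidableEq 𝒳₁] [Fintype 𝒳₂] [DecidableEq 𝒳₂]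
  [Fintype 𝒴₁] [DecidableEq 𝒴₁] [Fintype 𝒴₂] [DecidableEq 𝒴₂] {r D : ℕ}

/-- `p` is the law of auxiliary variables in `Fin D` for an interactive scheme, together with the
sources and the outputs. -/
def IsSchemeLaw (p : (Fin r → Fin D) × 𝒳₁ × 𝒳₂ × 𝒴₁ × 𝒴₂ → ℝ) : Prop :=
  IsPMF p ∧ IsInteractive p (fun i a => a.1 i) (fun a => a.2.1) (fun a => a.2.2.1)
    (fun a => a.2.2.2.1) (fun a => a.2.2.2.2)

theorem isClosed_setOf_isInteractive :
    IsClosed {p : (Fin r → Fin D) × 𝒳₁ × 𝒳₂ × 𝒴₁ × 𝒴₂ → ℝ |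
      IsInteractive p (fun i a => a.1 i) (fun a => a.2.1) (fun a => a.2.2.1)
        (fun a => a.2.2.2.1) (fun a => a.2.2.2.2)} := by
  have h : ∀ {α β γ : Type} [Fintype α] [Fintype β] [Fintype γ] [DecidableEq α] [DecidableEq β]
      [DecidableEq γ] (A : (Fin r → Fin D) × 𝒳₁ × 𝒳₂ × 𝒴₁ × 𝒴₂ → α)
      (B : (Fin r → Fin D) × 𝒳₁ × 𝒳₂ × 𝒴₁ × 𝒴₂ → β) (Z : (Fin r → Fin D) × 𝒳₁ × 𝒳₂ × 𝒴₁ × 𝒴₂ → γ),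
      IsClosed {p | cmi p A B Z = 0} :=
    fun A B Z => isClosed_eq (continuous_cmi A B Z) continuous_const
  have heq : {p : (Fin r → Fin D) × 𝒳₁ × 𝒳₂ × 𝒴₁ × 𝒴₂ → ℝ |
      IsInteractive p (fun i a => a.1 i) (fun a => a.2.1) (fun a => a.2.2.1)
        (fun a => a.2.2.2.1) (fun a => a.2.2.2.2)} =
      (⋂ (i : Fin r) (_ : (i : ℕ) % 2 = 0), {p | cmi p (fun a => a.1 i) (fun a => a.2.2.1)
        (fun a => ((fun j : Fin (i : ℕ) => a.1 ⟨j.1, j.2.trans i.2⟩), a.2.1)) = 0}) ∩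
      (⋂ (i : Fin r) (_ : (i : ℕ) % 2 = 1), {p | cmi p (fun a => a.1 i) (fun a => a.2.1)
        (fun a => ((fun j : Fin (i : ℕ) => a.1 ⟨j.1, j.2.trans i.2⟩), a.2.2.1)) = 0}) ∩
      ({p | cmi p (fun a => a.2.2.2.1) (fun a => (a.2.2.1, a.2.2.2.2))
        (fun a => (a.1, a.2.1)) = 0} ∩
      {p | cmi p (fun a => a.2.2.2.2) (fun a => (a.2.1, a.2.2.2.1))
        (fun a => (a.1, a.2.2.1)) = 0}) := by
    ext p
    simp only [Set.mem_ofPred_eq, Set.mem_inter_iff, Set.mem_iInter]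
    exact ⟨fun h => ⟨⟨h.odd, h.even⟩, h.out₁, h.out₂⟩, fun h => ⟨h.1.1, h.1.2, h.2.1, h.2.2⟩⟩
  rw [heq]
  exact ((isClosed_iInter fun i => isClosed_iInter fun _ => h _ _ _).inter
    (isClosed_iInter fun i => isClosed_iInter fun _ => h _ _ _)).inter
    ((h _ _ _).inter (h _ _ _))

/-- Interactive schemes whose target law is close to `q` can be replaced by schemes with target
law `q` and almost the same rates. -/
theorem exists_isSchemeLaw_of_l1dist_le (q : 𝒳₁ × 𝒳₂ × 𝒴₁ × 𝒴₂ → ℝ) (r D : ℕ) {δ : ℝ} (hδ : 0 < δ) :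
    ∃ ε > 0, ∀ p : (Fin r → Fin D) × 𝒳₁ × 𝒳₂ × 𝒴₁ × 𝒴₂ → ℝ, IsSchemeLaw p →
      l1dist (distr p Prod.snd) q ≤ ε → ∃ p' : (Fin r → Fin D) × 𝒳₁ × 𝒳₂ × 𝒴₁ × 𝒴₂ → ℝ,
        IsSchemeLaw p' ∧ distr p' Prod.snd = q ∧
        cmi p' (fun a => a.2.1) (fun a => a.1) (fun a => a.2.2.1) ≤
          cmi p (fun a => a.2.1) (fun a => a.1) (fun a => a.2.2.1) + δ ∧
        cmi p' (fun a => a.2.2.1) (fun a => a.1) (fun a => a.2.1) ≤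
          cmi p (fun a => a.2.2.1) (fun a => a.1) (fun a => a.2.1) + δ := by
  by_contra! hcon
  choose p hp hpq hbad using fun m : ℕ => hcon (1 / (m + 1)) Nat.one_div_pos_of_nat
  obtain ⟨p', ⟨hp'1, hp'2⟩, φ, hφ, hlim⟩ :=
    (isCompact_setOf_isPMF.inter_right isClosed_setOf_isInteractive).tendsto_subseq
      (fun m => ⟨(hp m).1, (hp m).2⟩)
  have hcont : Continuous fun p : (Fin r → Fin D) × 𝒳₁ × 𝒳₂ × 𝒴₁ × 𝒴₂ → ℝ =>
      l1dist (distr p Prod.snd) q :=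
    continuous_finsetSum _ fun a _ => ((continuous_distr _ a).sub continuous_const).abs
  have h0 : l1dist (distr p' Prod.snd) q ≤ 0 :=
    le_of_tendsto_of_tendsto ((hcont.tendsto p').comp hlim)
      (tendsto_one_div_add_atTop_nhds_zero_nat.comp hφ.tendsto_atTop)
      (Filter.Eventually.of_forall fun m => hpq (φ m))
  have hq' : distr p' Prod.snd = q := by
    have h1 := (Finset.sum_eq_zero_iff_of_nonneg fun a _ => abs_nonneg _).1
      (le_antisymm h0 (Finset.sum_nonneg fun a _ => abs_nonneg _))
    funext a
    exact sub_eq_zero.1 (abs_eq_zero.1 (h1 a (Finset.mem_univ a)))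
  have t1 := ((continuous_cmi (fun a : (Fin r → Fin D) × 𝒳₁ × 𝒳₂ × 𝒴₁ × 𝒴₂ => a.2.1)
    (fun a => a.1) (fun a => a.2.2.1)).tendsto p').comp hlim
  have t2 := ((continuous_cmi (fun a : (Fin r → Fin D) × 𝒳₁ × 𝒳₂ × 𝒴₁ × 𝒴₂ => a.2.2.1)
    (fun a => a.1) (fun a => a.2.1)).tendsto p').comp hlim
  obtain ⟨m, hm1, hm2⟩ := ((t1.eventually_const_lt (sub_lt_self _ hδ)).and
    (t2.eventually_const_lt (sub_lt_self _ hδ))).exists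
  have := hbad (φ m) p' ⟨hp'1, hp'2⟩ hq' (by simp only [Function.comp] at hm1; linarith)
  simp only [Function.comp] at hm2
  linarith

theorem IsInteractive.isSchemeLaw [Fintype Ω] {ν : Ω → ℝ} (hν : IsPMF ν)
    {G : Fin r → Ω → Fin D} {X₁ : Ω → 𝒳₁} {X₂ : Ω → 𝒳₂} {Y₁ : Ω → 𝒴₁} {Y₂ : Ω → 𝒴₂}
    (h : IsInteractive ν G X₁ X₂ Y₁ Y₂) :
    IsSchemeLaw (distr ν fun ω => ((fun i => G i ω), X₁ ω, X₂ ω, Y₁ ω, Y₂ ω)) :=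
  ⟨hν.distr _, fun i hi => by rw [cmi_distr]; exact h.odd i hi,
    fun i hi => by rw [cmi_distr]; exact h.even i hi,
    by rw [cmi_distr]; exact h.out₁, by rw [cmi_distr]; exact h.out₂⟩

end Limit

section Assembly

variable [Fintype 𝒳₁] [DecidableEq 𝒳₁] [Fintype 𝒳₂] [DecidableEq 𝒳₂]
  [Fintype 𝒴₁] [DecidableEq 𝒴₁] [Fintype 𝒴₂] [DecidableEq 𝒴₂]

/-- The rates achieved by a block code, up to `2 * δ`, belong to every convex set that contains the
single-letter rate region. -/
theorem Admissible.add_mem {q : 𝒳₁ × 𝒳₂ × 𝒴₁ × 𝒴₂ → ℝ} (hq : IsPMF q) {r : ℕ} (hr : 1 ≤ r)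
    {R12 R21 : ℝ} (hadm : Admissible q r R12 R21) {K : Set (ℝ × ℝ)} (hK : Convex ℝ K)
    (hmem : ∀ (p : (Fin r → Fin (Fintype.card (𝒳₁ × 𝒳₂ × 𝒴₁ × 𝒴₂))) × 𝒳₁ × 𝒳₂ × 𝒴₁ × 𝒴₂ → ℝ)
      (R : ℝ × ℝ), IsSchemeLaw p → distr p Prod.snd = q →
      cmi p (fun a => a.2.1) (fun a => a.1) (fun a => a.2.2.1) ≤ R.1 →
      cmi p (fun a => a.2.2.1) (fun a => a.1) (fun a => a.2.1) ≤ R.2 →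
      cmi p (fun a => a.2.1) (fun a => a.1) (fun a => a.2.2.1)
          + cmi p (fun a => a.2.2.1) (fun a => a.1) (fun a => a.2.1)
          + cmi q (fun a => a.2.2.1) (fun a => a.2.2.2) (fun a => (a.1, a.2.1)) ≤ R.1 + R.2 →
      R ∈ K) {δ : ℝ} (hδ : 0 < δ) : (R12 + 2 * δ, R21 + 2 * δ) ∈ K := by
  obtain ⟨ε₀, hε₀, hclose⟩ := exists_isSchemeLaw_of_l1dist_le q r
    (Fintype.card (𝒳₁ × 𝒳₂ × 𝒴₁ × 𝒴₂)) hδ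
  have hl := Real.log_pos one_lt_two
  set L : ℝ := Real.log (Fintype.card (𝒴₁ × 𝒳₁ × 𝒳₂)) + Real.log (Fintype.card (𝒴₂ × 𝒳₁ × 𝒳₂)) +
    Real.log (Fintype.card (𝒴₁ × 𝒴₂ × 𝒳₁ × 𝒳₂)) + Real.log (Fintype.card (𝒳₁ × 𝒳₂)) with hL
  have hL0 : 0 ≤ L := by
    have h (m : ℕ) : 0 ≤ Real.log m := Real.log_natCast_nonneg m
    have := h (Fintype.card (𝒴₁ × 𝒳₁ × 𝒳₂))
    have := h (Fintype.card (𝒴₂ × 𝒳₁ × 𝒳₂))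
    have := h (Fintype.card (𝒴₁ × 𝒴₂ × 𝒳₁ × 𝒳₂))
    have := h (Fintype.card (𝒳₁ × 𝒳₂))
    linarith
  set ε := min ε₀ (δ * Real.log 2 / (L + 1)) with hε
  have hεpos : 0 < ε := lt_min hε₀ (by positivity)
  have hεL : ε * L ≤ δ * Real.log 2 := by
    have h1 : ε * (L + 1) ≤ δ * Real.log 2 :=
      (le_div_iff₀ (by positivity)).1 (min_le_right _ _)
    nlinarith
  obtain ⟨n₀, hn₀⟩ := hadm ε hεpos
  obtain ⟨n₁, hn₁⟩ := exists_nat_ge (4 / (δ * Real.log 2))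
  set n := n₀ + n₁ + 1 with hn
  have hnpos : (0 : ℝ) < n := by positivity
  have hn4 : 4 ≤ n * (δ * Real.log 2) := by
    rw [← div_le_iff₀ (by positivity)]
    refine hn₁.trans ?_
    rw [hn]; push_cast; linarith [Nat.cast_nonneg (α := ℝ) n₀]
  obtain ⟨Ω, 𝓜₁, 𝓜₂, 𝓒, _, _, _, _, _, _, _, _, μ, X₁, X₂, M₁, M₂, C, Y₁, Y₂, hμ, hsrc, hind,
    hodd, heven, hR12, hR21, hout₁, hout₂, hdist⟩ := hn₀ n (by omega)
  have hcode := isCode_of_admissible hq hμ hsrc hind hodd heven hout₁ hout₂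
  obtain ⟨r1, r2, r12⟩ := hcode.sum_rates_le hr hR12 hR21
  have hblock := cmi_block_ge hμ hq (l1dist_letters.trans_le hdist)
    (fun a => a.2.2.1) (fun a => a.2.2.2) (fun a => (a.1, a.2.1))
  have hblock' : cmi μ Y₁ Y₂ (fun ω => (X₁ ω, X₂ ω)) = cmi μ (fun ω k => Y₁ ω k)
      (fun ω k => Y₂ ω k) (fun ω k => (X₁ ω k, X₂ ω k)) := by
    refine cmi_congr hμ.1 ?_ ?_ ?_ ?_ ?_ ?_ <;> intro ω ω' _ _ e <;>
      simp only [Prod.mk.injEq, funext_iff, forall_and] at e ⊢ <;> tauto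
  simp only [← hL] at hblock
  rw [← hblock'] at hblock
  set a : Fin n → ℝ := fun k => cmi μ (fun ω => X₁ ω k)
    (fun ω => fun i => auxMsg X₁ X₂ C k i ω) (fun ω => X₂ ω k) with ha
  set b : Fin n → ℝ := fun k => cmi μ (fun ω => X₂ ω k)
    (fun ω => fun i => auxMsg X₁ X₂ C k i ω) (fun ω => X₁ ω k) with hb
  set I := cmi q (fun a => a.2.2.1) (fun a => a.2.2.2) (fun a => (a.1, a.2.1)) with hI
  set s : ℝ := R12 - (∑ k, a k) / n + δ with hs
  set t : ℝ := R21 - (∑ k, b k) / n + δ with ht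
  have hs0 : 0 ≤ s := by
    have : (∑ k, a k) / n ≤ R12 := by rw [div_le_iff₀ hnpos]; linarith
    linarith
  have ht0 : 0 ≤ t := by
    have : (∑ k, b k) / n ≤ R21 := by rw [div_le_iff₀ hnpos]; linarith
    linarith
  have hst : I ≤ s + t := by
    have h1 : n * I ≤ cmi μ Y₁ Y₂ (fun ω => (X₁ ω, X₂ ω)) + n * (2 * δ) := by
      refine le_of_mul_le_mul_right ?_ hl
      nlinarith [mul_le_mul_of_nonneg_left hεL hnpos.le]
    have h2 : n * (s + t) = n * R12 + n * R21 - ∑ k, a k - ∑ k, b k + n * (2 * δ) := by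
      rw [hs, ht]
      field_simp
      ring
    refine le_of_mul_le_mul_left ?_ hnpos
    linarith
  have hletter : ∀ k, (a k, b k) + (δ + s, δ + t) ∈ K := by
    intro k
    refine (hcode.isInteractive hr k).rates_mem (K := (fun x => x + (δ + s, δ + t)) ⁻¹' K)
      (hK.translate_preimage_left _) ?_ hμ rfl
    intro ν G hν hG hv
    have hsnd : distr (distr ν fun ω => ((fun i => G i ω), X₁ ω k, X₂ ω k, Y₁ ω k, Y₂ ω k))
        Prod.snd = distr μ (fun ω => (X₁ ω k, X₂ ω k, Y₁ ω k, Y₂ ω k)) := by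
      rw [distr_distr]
      exact hv
    obtain ⟨p, hp, hpq, hp1, hp2⟩ := hclose _ (hG.isSchemeLaw hν) (by
      rw [hsnd]
      exact (l1dist_letter_le hq k).trans (hdist.trans (min_le_left _ _)))
    rw [cmi_distr] at hp1 hp2
    refine hmem p _ hp hpq ?_ ?_ ?_ <;> simp only [Prod.fst_add, Prod.snd_add] <;> linarith
  have hsum := hK.sum_mem (t := Finset.univ) (w := fun _ : Fin n => (n : ℝ)⁻¹)
    (z := fun k => (a k, b k) + (δ + s, δ + t)) (fun _ _ => by positivity)
    (by simp [hnpos.ne']) fun k _ => hletter k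
  convert hsum using 1
  rw [← Finset.smul_sum, Finset.sum_add_distrib]
  ext
  · simp only [hs, Finset.sum_const, Finset.card_univ, Fintype.card_fin, Prod.smul_fst,
      Prod.fst_add, Prod.fst_sum, smul_eq_mul]
    simp only [nsmul_eq_mul]
    field_simp
    ring
  · simp only [ht, Finset.sum_const, Finset.card_univ, Fintype.card_fin, Prod.smul_snd,
      Prod.snd_add, Prod.snd_sum, smul_eq_mul]
    simp only [nsmul_eq_mul]
    field_simp
    ring

end Assembly

/-- Theorem 2 of the paper, converse for `r` rounds. If `(R12, R21)`
is admissible for `q` with `r ≥ 1` interactive rounds of communication, then `(R12, R21)`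
lies in the closed convex hull of the pairs `(R'₁₂, R'₂₁)` for which there are finite
auxiliary alphabets `𝓕 i` and a pmf `p(f₁,…,f_r,x¹,x²,y¹,y²)` with
`(x¹,x²,y¹,y²)`-marginal `q`, satisfying the interactive Markov chains, the two
reconstruction Markov chains, and the cardinality bounds, such that
`R'₁₂ ≥ I_p(X¹; F | X²)`, `R'₂₁ ≥ I_p(X²; F | X¹)`, and
`R'₁₂ + R'₂₁ ≥ I_p(X¹; F | X²) + I_p(X²; F | X¹) + I_q(Y¹; Y² | X¹, X²)`.
Coordinates on `((i : Fin r) → 𝓕 i) × 𝒳₁ × 𝒳₂ × 𝒴₁ × 𝒴₂`: `a.1 = f`, `a.2.1 = x¹`,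
`a.2.2.1 = x²`, `a.2.2.2.1 = y¹`, `a.2.2.2.2 = y²`; messages with even Lean index
(odd 1-based index) are sent by the first node. -/
theorem multi_round_converse
    [Fintype 𝒳₁] [DecidableEq 𝒳₁] [Fintype 𝒳₂] [DecidableEq 𝒳₂]
    [Fintype 𝒴₁] [DecidableEq 𝒴₁] [Fintype 𝒴₂] [DecidableEq 𝒴₂]
    (q : 𝒳₁ × 𝒳₂ × 𝒴₁ × 𝒴₂ → ℝ) (hq : IsPMF q)
    (r : ℕ) (hr : 1 ≤ r) (R12 R21 : ℝ)
    (hadm : Admissible q r R12 R21) :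
    (R12, R21) ∈ closure (convexHull ℝ
      {R : ℝ × ℝ | ∃ (𝓕 : Fin r → Type)
        (_ : ∀ i, Fintype (𝓕 i)) (_ : ∀ i, DecidableEq (𝓕 i))
        (p : ((i : Fin r) → 𝓕 i) × 𝒳₁ × 𝒳₂ × 𝒴₁ × 𝒴₂ → ℝ),
        IsPMF p ∧
        -- the (x¹,x²,y¹,y²)-marginal of p is q
        (∀ x₁ x₂ y₁ y₂, (∑ f, p (f, x₁, x₂, y₁, y₂)) = q (x₁, x₂, y₁, y₂)) ∧
        -- F_i – (F_{1:i-1}, X¹) – X² for odd (1-based) i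
        (∀ i : Fin r, (i : ℕ) % 2 = 0 →
          cmi p (fun a => a.1 i) (fun a => a.2.2.1)
            (fun a => ((fun j : Fin (i : ℕ) => a.1 ⟨j.1, j.2.trans i.2⟩), a.2.1)) = 0) ∧
        -- F_i – (F_{1:i-1}, X²) – X¹ for even (1-based) i
        (∀ i : Fin r, (i : ℕ) % 2 = 1 →
          cmi p (fun a => a.1 i) (fun a => a.2.1)
            (fun a => ((fun j : Fin (i : ℕ) => a.1 ⟨j.1, j.2.trans i.2⟩), a.2.2.1)) = 0) ∧
        -- Y¹ – (F, X¹) – (X², Y²)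
        cmi p (fun a => a.2.2.2.1) (fun a => (a.2.2.1, a.2.2.2.2))
          (fun a => (a.1, a.2.1)) = 0 ∧
        -- Y² – (F, X²) – (X¹, Y¹)
        cmi p (fun a => a.2.2.2.2) (fun a => (a.2.1, a.2.2.2.1))
          (fun a => (a.1, a.2.2.1)) = 0 ∧
        -- cardinality bounds
        (∀ i : Fin r, Fintype.card (𝓕 i) ≤
          (∏ j ∈ Finset.univ.filter (fun j : Fin r => j < i), Fintype.card (𝓕 j)) *
            (Fintype.card 𝒳₁ * Fintype.card 𝒴₁ * Fintype.card 𝒳₂ * Fintype.card 𝒴₂)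
            + 1) ∧
        -- rate constraints
        R.1 ≥ cmi p (fun a => a.2.1) (fun a => a.1) (fun a => a.2.2.1) ∧
        R.2 ≥ cmi p (fun a => a.2.2.1) (fun a => a.1) (fun a => a.2.1) ∧
        R.1 + R.2 ≥ cmi p (fun a => a.2.1) (fun a => a.1) (fun a => a.2.2.1)
          + cmi p (fun a => a.2.2.1) (fun a => a.1) (fun a => a.2.1)
          + cmi q (fun a => a.2.2.1) (fun a => a.2.2.2) (fun a => (a.1, a.2.1))}) := by

  set S := {R : ℝ × ℝ | _} with hS
  have key := fun δ (hδ : 0 < δ) => hadm.add_mem hq hr (δ := δ)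
    (K := closure (convexHull ℝ S)) (convex_convexHull ℝ S).closure ?_ hδ
  · have hlim : Filter.Tendsto (fun m : ℕ => (R12 + 2 * (1 / ((m : ℝ) + 1)),
        R21 + 2 * (1 / ((m : ℝ) + 1)))) Filter.atTop (nhds (R12 + 2 * 0, R21 + 2 * 0)) :=
      ((tendsto_one_div_add_atTop_nhds_zero_nat.const_mul 2).const_add R12).prodMk_nhds
        ((tendsto_one_div_add_atTop_nhds_zero_nat.const_mul 2).const_add R21)
    simp only [mul_zero, add_zero] at hlim
    exact isClosed_closure.mem_of_tendsto hlim
      (Filter.Eventually.of_forall fun m => key _ Nat.one_div_pos_of_nat)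
  · intro p R hp hpq h1 h2 h3
    refine subset_closure (subset_convexHull ℝ S ⟨fun _ => Fin (Fintype.card (𝒳₁ × 𝒳₂ × 𝒴₁ × 𝒴₂)),
      fun _ => inferInstance, fun _ => inferInstance, p, hp.1, fun x₁ x₂ y₁ y₂ => ?_, hp.2.odd,
      hp.2.even, hp.2.out₁, hp.2.out₂, fun i => ?_, h1, h2, h3⟩)
    · rw [← hpq]
      simp only [distr]
      rw [Fintype.sum_prod_type]
      exact Finset.sum_congr rfl fun f _ => by simp
    · have := hq.nonempty
      have hpos : 0 < Fintype.card (𝒳₁ × 𝒳₂ × 𝒴₁ × 𝒴₂) := Fintype.card_pos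
      simp only [Fintype.card_fin, Finset.prod_const]
      have hc : Fintype.card 𝒳₁ * Fintype.card 𝒴₁ * Fintype.card 𝒳₂ * Fintype.card 𝒴₂ =
          Fintype.card (𝒳₁ × 𝒳₂ × 𝒴₁ × 𝒴₂) := by
        simp only [Fintype.card_prod]
        ring
      rw [hc]
      exact (Nat.le_mul_of_pos_left _ (Nat.pow_pos hpos)).trans (Nat.le_succ _)

end Coord
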